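/- arXiv:2002.02731 — 12 statements merged into one kernel-verified Lean document; each statement's English description precedes it below -/
import Mathlib

section
/- Let b ≥ 2 be an integer and let t be a positive divisor of b. Then for all positive integers n and r, there exists a positive integer j such that s_b(j·n) = r if and only if there exists a positive integer k such that s_b(k·t·n) = r. -/
theorem stmt_0 (b t n r : ℕ) (hb : 2 ≤ b) (ht : 0 < t) (htb : t ∣ b)
    (hn : 1 ≤ n) (hr : 1 ≤ r) :
    (∃ j : ℕ, 1 ≤ j ∧ (Nat.digits b (j * n)).sum = r) ↔
      (∃ k : ℕ, 1 ≤ k ∧ (Nat.digits b (k * t * n)).sum = r) := by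
  constructor
  · -- Multiplying `j * n` by `b` only appends a zero digit.
    rintro ⟨j, hj, hsum⟩
    obtain ⟨c, rfl⟩ := htb
    have hc : 0 < c := Nat.pos_of_ne_zero (by rintro rfl; simp at hb)
    refine ⟨j * c, Nat.mul_pos hj hc, ?_⟩
    have hmul : j * c * t * n = t * c * (j * n) := by ring
    rw [hmul, Nat.digits_base_mul hb (Nat.mul_pos hj hn)]
    simpa using hsum
  · rintro ⟨k, hk, hsum⟩
    exact ⟨k * t, Nat.mul_pos hk ht, hsum⟩
end

section
/- Let b ≥ 2 be an integer and n a positive integer. Let g be the largest divisor of n all of whose prime factors divide b (that is, g = ∏ p^{ν_p(n)} over all primes p dividing both n and b, where ν_p(n) is the p-adic valuation of n). Then swm_b(n) = swm_b(n/g) and gcd(b, n/g) = 1. -/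
/-- `swm b n` is the smallest base-`b` digit sum of a positive multiple of `n`. -/
noncomputable def swm (b n : ℕ) : ℕ :=
  sInf {s : ℕ | ∃ k : ℕ, 1 ≤ k ∧ (Nat.digits b (k * n)).sum = s}

theorem sum_digits_base_pow_mul {b : ℕ} (hb : 1 < b) (m a : ℕ) :
    (Nat.digits b (b ^ m * a)).sum = (Nat.digits b a).sum := by
  rcases Nat.eq_zero_or_pos a with rfl | ha
  · simp
  · simp [Nat.digits_base_pow_mul hb ha]

/-- A factor dividing a power of the base does not affect the minimal digit sum of multiples. -/
theorem swm_mul_of_dvd_pow {b g m : ℕ} (hb : 1 < b) (hg : g ∣ b ^ m) (h : ℕ) :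
    swm b (g * h) = swm b h := by
  obtain ⟨c, hc⟩ := hg
  have hgc : 0 < g * c := hc ▸ pow_pos (by lia) m
  have hg0 : 0 < g := pos_of_mul_pos_left hgc c.zero_le
  have hc0 : 0 < c := pos_of_mul_pos_right hgc g.zero_le
  unfold swm
  congr 1
  ext s
  constructor
  · rintro ⟨k, hk, hs⟩
    exact ⟨k * g, Nat.mul_pos hk hg0, by rwa [mul_assoc]⟩
  · rintro ⟨k, hk, hs⟩
    refine ⟨k * c, Nat.mul_pos hk hc0, ?_⟩
    rw [← hs, ← sum_digits_base_pow_mul hb m (k * h), hc]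
    congr 2
    ring

theorem stmt_1 (b n : ℕ) (hb : 2 ≤ b) (hn : 1 ≤ n)
    (g : ℕ) (hg : g = ∏ p ∈ n.primeFactors.filter (· ∣ b), p ^ n.factorization p) :
    swm b n = swm b (n / g) ∧ Nat.gcd b (n / g) = 1 := by
  set h := ∏ p ∈ n.primeFactors.filter (¬ · ∣ b), p ^ n.factorization p with hh
  have hgh : g * h = n := by
    rw [hg, hh, Finset.prod_filter_mul_prod_filter_not]
    exact Nat.prod_factorization_pow_eq_self (by lia)
  have hg0 : 0 < g := Nat.pos_of_ne_zero fun h0 => by simp [h0] at hgh; lia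
  have hdvd : g ∣ b ^ ∑ p ∈ n.primeFactors.filter (· ∣ b), n.factorization p := by
    rw [hg, ← Finset.prod_pow_eq_pow_sum]
    exact Finset.prod_dvd_prod_of_dvd _ _ fun p hp =>
      pow_dvd_pow_of_dvd (Finset.mem_filter.mp hp).2 _
  have hdiv : n / g = h := by rw [← hgh, Nat.mul_div_cancel_left _ hg0]
  rw [hdiv]
  refine ⟨by rw [← swm_mul_of_dvd_pow hb hdvd h, hgh], ?_⟩
  refine Nat.Coprime.prod_right fun p hp => Nat.Coprime.pow_right _ ?_
  obtain ⟨hpn, hpb⟩ := Finset.mem_filter.mp hp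
  exact ((Nat.prime_of_mem_primeFactors hpn).coprime_iff_not_dvd.mpr hpb).symm
end

section
/- Let b ≥ 2 and let n, t be positive integers. There exists a positive integer j such that s_b(j·n) = t if and only if there exist t distinct nonnegative integers m_1 < m_2 < ⋯ < m_t such that n divides b^{m_1} + b^{m_2} + ⋯ + b^{m_t} (i.e., t distinct powers of b sum to a positive multiple of n). -/
/-- Every natural number is a sum of as many powers of `b` as its base-`b` digit sum. -/
theorem exists_list_pow_sum_eq_ofDigits (b : ℕ) (D : List ℕ) :
    ∃ L : List ℕ, L.length = D.sum ∧ (L.map (b ^ ·)).sum = Nat.ofDigits b D := by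
  induction D with
  | nil => exact ⟨[], by simp⟩
  | cons d D ih =>
    obtain ⟨L, hlen, hsum⟩ := ih
    refine ⟨List.replicate d 0 ++ L.map (· + 1), by simp [hlen], ?_⟩
    rw [Nat.ofDigits_cons, ← hsum, ← List.sum_map_mul_left]
    simp [Function.comp_def, pow_succ']

theorem exists_fin_pow_sum_eq (b x : ℕ) :
    ∃ e : Fin (Nat.digits b x).sum → ℕ, ∑ i, b ^ e i = x := by
  obtain ⟨L, hlen, hsum⟩ := exists_list_pow_sum_eq_ofDigits b (Nat.digits b x)
  rw [← hlen]
  rw [Nat.ofDigits_digits] at hsum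
  exact ⟨fun i => L[i], (Fin.sum_univ_fun_getElem L (b ^ ·)).trans hsum⟩

theorem sum_digits_sum_pow {b : ℕ} (hb : 2 ≤ b) (s : Finset ℕ) :
    (Nat.digits b (∑ i ∈ s, b ^ i)).sum = s.card := by
  induction s using Finset.induction_on_max with
  | empty => simp
  | insert a s ha ih =>
    have hlt : ∑ i ∈ s, b ^ i < b ^ a := Nat.geomSum_lt hb ha
    have hlen := (Nat.digits_length_le_iff (show 1 < b by omega) _).2 hlt
    have happ := Nat.digits_append_zeroes_append_digits (b := b) (m := 1)
      (k := a - (Nat.digits b (∑ i ∈ s, b ^ i)).length) (n := ∑ i ∈ s, b ^ i)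
      (by omega) one_pos
    rw [Nat.add_sub_cancel' hlen, mul_one] at happ
    have has : a ∉ s := fun h => lt_irrefl a (ha a h)
    rw [Finset.sum_insert has, add_comm, ← happ, Finset.card_insert_of_notMem has,
      Nat.digits_of_lt b 1 one_ne_zero (by omega)]
    simp [ih]

/-- The powers of `b` are eventually periodic modulo `n`. -/
theorem exists_pow_add_mul_modEq (b : ℕ) {n : ℕ} (hn : 1 ≤ n) :
    ∃ N p : ℕ, 0 < p ∧ ∀ e k : ℕ, b ^ (e + N + p * k) ≡ b ^ (e + N) [MOD n] := by
  have : NeZero n := ⟨by omega⟩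
  obtain ⟨x, y, hxy, h⟩ :=
    Finite.exists_ne_map_eq_of_infinite (fun k : ℕ => ((b ^ k : ℕ) : ZMod n))
  wlog hlt : x < y generalizing x y
  · exact this y x hxy.symm h.symm (by omega)
  obtain ⟨p, rfl⟩ := Nat.exists_eq_add_of_lt hlt
  have hper : b ^ x ≡ b ^ (x + p + 1) [MOD n] := (ZMod.natCast_eq_natCast_iff _ _ _).1 h
  refine ⟨x, p + 1, p.succ_pos, fun e k => ?_⟩
  induction k with
  | zero => rfl
  | succ k ih =>
    refine Nat.ModEq.trans ?_ ih
    have := (hper.mul_left (b ^ (e + (p + 1) * k))).symm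
    simp only [← pow_add] at this
    convert this using 2 <;> ring

theorem stmt_2 (b n t : ℕ) (hb : 2 ≤ b) (hn : 1 ≤ n) (ht : 1 ≤ t) :
    (∃ j : ℕ, 1 ≤ j ∧ (Nat.digits b (j * n)).sum = t) ↔
      (∃ m : Fin t → ℕ, StrictMono m ∧ n ∣ ∑ i : Fin t, b ^ m i) := by
  constructor
  · rintro ⟨j, -, rfl⟩
    obtain ⟨e, he⟩ := exists_fin_pow_sum_eq b (j * n)
    obtain ⟨N, p, hp, hper⟩ := exists_pow_add_mul_modEq b hn
    set M := Finset.univ.sup e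
    refine ⟨fun i => e i + N + p * ((M + 1) * i), fun i k hik => ?_, ?_⟩
    · have hi : e i ≤ M := Finset.le_sup (Finset.mem_univ i)
      have hik' : (i : ℕ) + 1 ≤ k := hik
      have hmul : p * ((M + 1) * (i + 1)) ≤ p * ((M + 1) * k) := by gcongr
      have hpM : M + 1 ≤ p * (M + 1) := Nat.le_mul_of_pos_left _ hp
      dsimp only
      linarith
    · have hmod : ∑ i, b ^ (e i + N + p * ((M + 1) * i)) ≡ ∑ i, b ^ (e i + N) [MOD n] :=
        Nat.ModEq.sum fun i _ => hper _ _
      refine (hmod.dvd_iff dvd_rfl).2 ?_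
      simp only [pow_add]
      rw [← Finset.sum_mul, he]
      exact (Dvd.intro_left j rfl).mul_right _
  · rintro ⟨m, hm, j, hj⟩
    have hsum : ∑ i ∈ Finset.univ.image m, b ^ i = j * n := by
      rw [Finset.sum_image hm.injective.injOn, hj, mul_comm]
    have hdigits := sum_digits_sum_pow hb (Finset.univ.image m)
    rw [hsum, Finset.card_image_of_injective _ hm.injective, Finset.card_fin] at hdigits
    refine ⟨j, Nat.one_le_iff_ne_zero.2 ?_, hdigits⟩
    rintro rfl
    simp at hdigits
    omega
end

section
/- Let b ≥ 2 and let j, n be positive integers with s_b(j·n) = t. Then for every integer r ≥ 0 there exists a positive integer k such that s_b(k·n) = t + r·(b − 1). -/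
theorem Nat.sum_digits_pow_mul {b : ℕ} (hb : 2 ≤ b) (k a : ℕ) :
    (Nat.digits b (b ^ k * a)).sum = (Nat.digits b a).sum := by
  rcases Nat.eq_zero_or_pos a with rfl | ha
  · simp
  · simp [Nat.digits_base_pow_mul (by omega : 1 < b) ha]

/-- The residue `a` modulo `n` contains naturals of base-`b` digit sum `s` divisible by
arbitrarily large powers of `b`. -/
def HasShiftedDigitSum (b n s : ℕ) (a : ZMod n) : Prop :=
  ∀ K : ℕ, ∃ m : ℕ, b ^ K ∣ m ∧ (Nat.digits b m).sum = s ∧ (m : ZMod n) = a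

theorem HasShiftedDigitSum.add {b n s s' : ℕ} {a a' : ZMod n} (hb : 2 ≤ b)
    (h : HasShiftedDigitSum b n s a) (h' : HasShiftedDigitSum b n s' a') :
    HasShiftedDigitSum b n (s + s') (a + a') := by
  intro K
  obtain ⟨m, hKm, hs, ha⟩ := h K
  obtain ⟨m', hm', hs', ha'⟩ := h' (K + (Nat.digits b m).length)
  refine ⟨m + m', dvd_add hKm ((pow_dvd_pow b (Nat.le_add_right _ _)).trans hm'), ?_, ?_⟩
  · obtain ⟨x, rfl⟩ := (pow_dvd_pow b (Nat.le_add_left _ K)).trans hm'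
    rw [Nat.sum_digits_pow_mul hb] at hs'
    rw [← Nat.digits_append_digits (by omega), List.sum_append, hs, hs']
  · rw [Nat.cast_add, ha, ha']

theorem HasShiftedDigitSum.natCast_mul {b n s : ℕ} {a : ZMod n} (hb : 2 ≤ b)
    (h : HasShiftedDigitSum b n s a) (c : ℕ) :
    HasShiftedDigitSum b n (c * s) (c * a) := by
  induction c with
  | zero => exact fun K => ⟨0, by simp⟩
  | succ c ih => simpa [add_mul] using ih.add hb h

theorem exists_pow_add_mul_eq (M : Type*) [Monoid M] [Finite M] (x : M) :
    ∃ e w : ℕ, 0 < w ∧ ∀ p K : ℕ, e ≤ p → x ^ (p + w * K) = x ^ p := by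
  obtain ⟨i, j, hij, hne⟩ : ∃ i j : ℕ, i < j ∧ x ^ i = x ^ j := by
    obtain ⟨i, j, hne, h⟩ := Finite.exists_ne_map_eq_of_infinite (fun k : ℕ => x ^ k)
    rcases lt_or_gt_of_ne hne with hlt | hlt
    · exact ⟨i, j, hlt, h⟩
    · exact ⟨j, i, hlt, h.symm⟩
  refine ⟨i, j - i, by omega, fun p K hp => ?_⟩
  induction K with
  | zero => simp
  | succ K ih =>
    rw [← ih, show p + (j - i) * (K + 1) = j + (p - i + (j - i) * K) by
      rw [mul_add]; omega, pow_add, ← hne, ← pow_add]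
    congr 1
    omega

theorem Nat.exists_eq_add_pow_sum_digits {b : ℕ} (hb : 2 ≤ b) (N : ℕ) (hN : 0 < N) :
    ∃ N' q : ℕ, N = N' + b ^ q ∧ (Nat.digits b N).sum = (Nat.digits b N').sum + 1 := by
  induction N using Nat.strong_induction_on with
  | _ N ih =>
    have sum_digits_add_mul : ∀ r x : ℕ, r < b →
        (Nat.digits b (r + b * x)).sum = r + (Nat.digits b x).sum := by
      intro r x hr
      by_cases h : r = 0 ∧ x = 0
      · simp [h.1, h.2]
      · rw [Nat.digits_add b (by omega) r x hr (by omega)]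
        simp
    have hdecomp := Nat.mod_add_div N b
    have hmod := Nat.mod_lt N (by omega : b > 0)
    rcases Nat.eq_zero_or_pos (N % b) with h0 | h0
    · have hdiv : 0 < N / b :=
      Nat.div_pos (Nat.le_of_dvd hN (Nat.dvd_of_mod_eq_zero h0)) (by omega)
      obtain ⟨N', q, heq, hsum⟩ := ih (N / b) (Nat.div_lt_self hN (by omega)) hdiv
      refine ⟨b * N', q + 1, ?_, ?_⟩
      · rw [pow_succ', ← mul_add, ← heq]
        omega
      · have h1 := sum_digits_add_mul (N % b) (N / b) hmod
        have h2 := sum_digits_add_mul 0 N' (by omega)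
        rw [hdecomp] at h1
        rw [zero_add] at h2
        omega
    · refine ⟨N % b - 1 + b * (N / b), 0, by rw [pow_zero]; omega, ?_⟩
      have h1 := sum_digits_add_mul (N % b) (N / b) hmod
      rw [hdecomp] at h1
      rw [h1, sum_digits_add_mul _ _ (by omega)]
      omega

theorem exists_dvd_sum_digits_add {b n N : ℕ} (hb : 2 ≤ b) (hn : 0 < n) (hN : 0 < N)
    (hnN : n ∣ N) :
    ∃ m : ℕ, 0 < m ∧ n ∣ m ∧ (Nat.digits b m).sum = (Nat.digits b N).sum + (b - 1) := by
  have : NeZero n := ⟨hn.ne'⟩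
  obtain ⟨e, w, hw, hper⟩ := exists_pow_add_mul_eq (ZMod n) (b : ZMod n)
  have shifted : ∀ x p : ℕ, e ≤ p →
      HasShiftedDigitSum b n (Nat.digits b x).sum ((b : ZMod n) ^ p * x) := by
    intro x p hp K
    refine ⟨b ^ (p + w * K) * x, ?_, Nat.sum_digits_pow_mul hb _ _, ?_⟩
    · exact (pow_dvd_pow b (by nlinarith)).mul_right x
    · push_cast
      rw [hper p K hp]
  obtain ⟨N', q, hNq, hsum⟩ := Nat.exists_eq_add_pow_sum_digits hb N hN
  have hpow := (shifted 1 (q + e) (by omega)).natCast_mul hb b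
  obtain ⟨m, -, hms, hm⟩ := (shifted N' (e + 1) (by omega)).add hb hpow 0
  have hone : (Nat.digits b 1).sum = 1 := by
    rw [Nat.digits_of_lt b 1 (by omega) (by omega)]
    simp
  rw [hone] at hms
  refine ⟨m, Nat.pos_of_ne_zero ?_, ?_, by omega⟩
  · rintro rfl
    simp at hms
    omega
  · rw [← ZMod.natCast_eq_zero_iff, hm]
    have hzero : ((N : ℕ) : ZMod n) = 0 := (ZMod.natCast_eq_zero_iff N n).2 hnN
    rw [hNq] at hzero
    push_cast at hzero ⊢
    linear_combination (b : ZMod n) ^ (e + 1) * hzero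

theorem stmt_3 (b j n t : ℕ) (hb : 2 ≤ b) (hj : 1 ≤ j) (hn : 1 ≤ n)
    (ht : (Nat.digits b (j * n)).sum = t) :
    ∀ r : ℕ, ∃ k : ℕ, 1 ≤ k ∧ (Nat.digits b (k * n)).sum = t + r * (b - 1) := by
  intro r
  induction r with
  | zero => exact ⟨j, hj, by simpa using ht⟩
  | succ r ih =>
    obtain ⟨k, hk, hsum⟩ := ih
    obtain ⟨m, hm, ⟨c, rfl⟩, hms⟩ :=
      exists_dvd_sum_digits_add hb hn (Nat.mul_pos hk hn) (dvd_mul_left n k)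
    refine ⟨c, Nat.pos_of_mul_pos_left hm, ?_⟩
    rw [mul_comm c n, hms, hsum]
    ring
end

section
/- Let n, b, j be positive integers with b ≥ 2 such that n divides b^j − 1. Then n is flimsy in base b if and only if s_b(k·n) < s_b(n) for some integer k satisfying 1 ≤ k ≤ (b^j − 1)/n. -/
theorem Nat.sum_digits_eq_mod_add_div {b : ℕ} (hb : 1 < b) (n : ℕ) :
    (Nat.digits b n).sum = n % b + (Nat.digits b (n / b)).sum := by
  rcases Nat.eq_zero_or_pos n with rfl | hn
  · simp
  · rw [Nat.digits_def' hb hn, List.sum_cons]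

theorem Nat.sum_digits_succ_le {b : ℕ} (hb : 1 < b) (n : ℕ) :
    (Nat.digits b (n + 1)).sum ≤ (Nat.digits b n).sum + 1 := by
  induction n using Nat.strong_induction_on with
  | _ n ih =>
    rw [Nat.sum_digits_eq_mod_add_div hb (n + 1), Nat.sum_digits_eq_mod_add_div hb n]
    by_cases h : b ∣ n + 1
    · rcases Nat.eq_zero_or_pos n with rfl | hn
      · rw [zero_add, Nat.dvd_one] at h
        omega
      · rw [Nat.succ_div_of_dvd h, Nat.mod_eq_zero_of_dvd h]
        have := ih (n / b) (Nat.div_lt_self hn hb)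
        omega
    · rw [Nat.succ_div_of_not_dvd h, Nat.add_mod, Nat.mod_eq_of_lt hb]
      have := Nat.mod_le (n % b + 1) b
      omega

theorem Nat.sum_digits_add_le {b : ℕ} (hb : 1 < b) (m n : ℕ) :
    (Nat.digits b (m + n)).sum ≤ (Nat.digits b m).sum + (Nat.digits b n).sum := by
  induction m using Nat.strong_induction_on generalizing n with
  | _ m ih =>
    rcases Nat.eq_zero_or_pos m with rfl | hm
    · simp
    rw [Nat.sum_digits_eq_mod_add_div hb (m + n), Nat.sum_digits_eq_mod_add_div hb m,
      Nat.sum_digits_eq_mod_add_div hb n]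
    have h₁ := ih (m / b) (Nat.div_lt_self hm hb) (n / b)
    have h₂ := Nat.sum_digits_succ_le hb (m / b + n / b)
    have h₃ := Nat.add_mod_add_ite m n b
    rw [Nat.add_div (by omega : 0 < b)]
    split_ifs at h₃ ⊢ <;> grind

theorem Nat.sum_digits_eq_mod_pow_add_div_pow {b : ℕ} (hb : 1 < b) (j n : ℕ) :
    (Nat.digits b n).sum =
      (Nat.digits b (n % b ^ j)).sum + (Nat.digits b (n / b ^ j)).sum := by
  induction j generalizing n with
  | zero => simp [Nat.mod_one]
  | succ j ih =>
    rw [Nat.sum_digits_eq_mod_add_div hb n, ih (n / b),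
      Nat.sum_digits_eq_mod_add_div hb (n % b ^ (j + 1)), pow_succ',
      Nat.mod_mul_right_mod, Nat.mod_mul_right_div_self, Nat.div_div_eq_div_mul, add_assoc]

/-- Folding the base-`b ^ j` digits of a multiple of a divisor of `b ^ j - 1` gives a multiple below
`b ^ j` whose digit sum is no larger. -/
theorem Nat.exists_dvd_lt_pow_sum_digits_le {n b j : ℕ} (hb : 1 < b) (hj : 1 ≤ j)
    (hdvd : n ∣ b ^ j - 1) (m : ℕ) (hm : 0 < m) (hnm : n ∣ m) :
    ∃ m', 0 < m' ∧ m' < b ^ j ∧ n ∣ m' ∧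
      (Nat.digits b m').sum ≤ (Nat.digits b m).sum := by
  induction m using Nat.strong_induction_on with
  | _ m ih =>
    rcases lt_or_ge m (b ^ j) with h | h
    · exact ⟨m, hm, h, hnm, le_rfl⟩
    have hpow : 1 < b ^ j := Nat.one_lt_pow (by omega) hb
    have hq : 0 < m / b ^ j := Nat.div_pos h (by omega)
    have hsplit : m = (m % b ^ j + m / b ^ j) + (b ^ j - 1) * (m / b ^ j) := by
      have hmod := Nat.mod_add_div m (b ^ j)
      have hle := Nat.le_mul_of_pos_left (m / b ^ j) (zero_lt_one.trans hpow)
      rw [Nat.sub_mul, one_mul]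
      omega
    have hlt : m % b ^ j + m / b ^ j < m := by
      have : 0 < (b ^ j - 1) * (m / b ^ j) := Nat.mul_pos (by omega) hq
      omega
    have hfold : n ∣ m % b ^ j + m / b ^ j := by
      rw [hsplit] at hnm
      exact (Nat.dvd_add_left (hdvd.mul_right _)).1 hnm
    obtain ⟨m', h₀, h₁, h₂, h₃⟩ := ih _ hlt (Nat.add_pos_right _ hq) hfold
    refine ⟨m', h₀, h₁, h₂, h₃.trans ?_⟩
    rw [Nat.sum_digits_eq_mod_pow_add_div_pow hb j m]
    exact Nat.sum_digits_add_le hb _ _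

theorem stmt_4 (n b j : ℕ) (hb : 2 ≤ b) (hn : 1 ≤ n) (hj : 1 ≤ j)
    (hdvd : n ∣ b ^ j - 1) :
    (∃ k : ℕ, 1 ≤ k ∧ (Nat.digits b (k * n)).sum < (Nat.digits b n).sum) ↔
      (∃ k : ℕ, 1 ≤ k ∧ k ≤ (b ^ j - 1) / n ∧
        (Nat.digits b (k * n)).sum < (Nat.digits b n).sum) := by
  constructor
  · rintro ⟨k, hk, hlt⟩
    obtain ⟨m, hm, hmj, ⟨c, rfl⟩, hle⟩ := Nat.exists_dvd_lt_pow_sum_digits_le hb hj hdvd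
      (k * n) (Nat.mul_pos hk hn) (Dvd.intro_left k rfl)
    rw [mul_comm] at hm hmj hle
    exact ⟨c, Nat.pos_of_mul_pos_right hm, (Nat.le_div_iff_mul_le hn).2 (by omega),
      hle.trans_lt hlt⟩
  · rintro ⟨k, hk, -, hlt⟩
    exact ⟨k, hk, hlt⟩
end

section
/- Let b ≥ 2 and j ≥ 1 be integers, and let m be a positive divisor of b − 1. Then (b^j − 1)/m is sturdy in base b. -/
/-- The value of a digit list placed at position `t`, with the exponents folded modulo `j`. -/
def foldedValue (b j : ℕ) : List ℕ → ℕ → ℕ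
  | [], _ => 0
  | a :: L, t => a * b ^ (t % j) + foldedValue b j L (t + 1)

theorem foldedValue_modEq {b j N : ℕ} (h : b ^ j ≡ 1 [MOD N]) (L : List ℕ) (t : ℕ) :
    foldedValue b j L t ≡ b ^ t * Nat.ofDigits b L [MOD N] := by
  induction L generalizing t with
  | nil => simp [foldedValue, Nat.ModEq.refl]
  | cons a L ih =>
    have hpow : b ^ (t % j) ≡ b ^ t [MOD N] := by
      conv_rhs => rw [← Nat.mod_add_div t j, pow_add, pow_mul]
      simpa using ((h.pow (t / j)).mul_left (b ^ (t % j))).symm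
    have hsum := (hpow.mul_left a).add (ih (t + 1))
    rw [foldedValue, Nat.ofDigits_cons]
    convert hsum using 1
    ring

theorem foldedValue_pos {b j : ℕ} (hb : 0 < b) (L : List ℕ) (t : ℕ)
    (h : Nat.ofDigits b L ≠ 0) : 0 < foldedValue b j L t := by
  induction L generalizing t with
  | nil => simp at h
  | cons a L ih =>
    rw [foldedValue]
    rcases Nat.eq_zero_or_pos a with rfl | ha
    · have : Nat.ofDigits b L ≠ 0 := by
        intro h0
        simp [Nat.ofDigits_cons, h0] at h
      have := ih (t + 1) this
      omega
    · positivity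

theorem sum_range_pow_add_mod (b j s : ℕ) :
    ∑ t ∈ Finset.range j, b ^ ((t + s) % j) = ∑ t ∈ Finset.range j, b ^ t := by
  induction s with
  | zero =>
    exact Finset.sum_congr rfl fun t ht => by
      rw [add_zero, Nat.mod_eq_of_lt (Finset.mem_range.mp ht)]
  | succ s ih =>
    rw [← ih]
    have h := Finset.sum_range_succ (fun t => b ^ ((t + s) % j)) j
    rw [Finset.sum_range_succ'] at h
    simp only [zero_add, Nat.add_mod_left] at h
    simpa only [add_assoc, add_comm 1 s] using Nat.add_right_cancel h

theorem sum_range_foldedValue (b j : ℕ) (L : List ℕ) (s : ℕ) :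
    ∑ t ∈ Finset.range j, foldedValue b j L (t + s) = L.sum * ∑ t ∈ Finset.range j, b ^ t := by
  induction L generalizing s with
  | nil => simp [foldedValue]
  | cons a L ih =>
    simp only [foldedValue, Finset.sum_add_distrib, add_assoc, ih, ← Finset.mul_sum,
      sum_range_pow_add_mod, List.sum_cons, add_mul]

theorem mul_le_digits_sum_mul_sum_pow {b j N n : ℕ} (hb : 2 ≤ b) (h : b ^ j ≡ 1 [MOD N])
    (hn : n ≠ 0) (hN : N ∣ n) :
    j * N ≤ (Nat.digits b n).sum * ∑ t ∈ Finset.range j, b ^ t := by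
  rw [← sum_range_foldedValue b j _ 0]
  have hle (t : ℕ) : N ≤ foldedValue b j (Nat.digits b n) (t + 0) := by
    refine Nat.le_of_dvd (foldedValue_pos (by omega) _ _ (by rwa [Nat.ofDigits_digits])) ?_
    refine (Nat.modEq_zero_iff_dvd).mp ((foldedValue_modEq h _ _).trans ?_)
    rw [Nat.ofDigits_digits]
    exact (Nat.modEq_zero_iff_dvd).mpr (hN.mul_left _)
  simpa using Finset.sum_le_sum fun t (_ : t ∈ Finset.range j) => hle t

theorem ofDigits_replicate (b j d : ℕ) :
    Nat.ofDigits b (List.replicate j d) = d * ∑ t ∈ Finset.range j, b ^ t := by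
  induction j with
  | zero => simp
  | succ j ih =>
    rw [List.replicate_succ, Nat.ofDigits_cons, ih, Finset.sum_range_succ']
    simp only [pow_succ, ← Finset.sum_mul]
    ring

theorem digits_mul_sum_pow {b d : ℕ} (j : ℕ) (hd : d ≠ 0) (hdb : d < b) :
    Nat.digits b (d * ∑ t ∈ Finset.range j, b ^ t) = List.replicate j d := by
  rw [← ofDigits_replicate]
  refine Nat.digits_ofDigits b (by omega) _ ?_ ?_
  · intro l hl
    rwa [List.eq_of_mem_replicate hl]
  · intro _
    simpa using hd

theorem stmt_5 (b j m : ℕ) (hb : 2 ≤ b) (hj : 1 ≤ j) (hm : 0 < m)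
    (hmdvd : m ∣ b - 1) :
    ∀ k : ℕ, 1 ≤ k →
      (Nat.digits b ((b ^ j - 1) / m)).sum ≤
        (Nat.digits b (k * ((b ^ j - 1) / m))).sum := by
  intro k hk
  obtain ⟨d, hd⟩ := hmdvd
  have hd0 : d ≠ 0 := by
    rintro rfl
    omega
  have hdb : d < b := by
    have := Nat.le_mul_of_pos_left d hm
    omega
  have hR : 0 < ∑ t ∈ Finset.range j, b ^ t :=
    Finset.sum_pos (fun t _ => by positivity) ⟨0, Finset.mem_range.mpr hj⟩
  have hgeom : b ^ j - 1 = m * (d * ∑ t ∈ Finset.range j, b ^ t) := by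
    rw [← mul_assoc, ← hd, Nat.geomSum_eq hb, Nat.mul_div_cancel']
    simpa using Nat.sub_dvd_pow_sub_pow b 1 j
  rw [hgeom, Nat.mul_div_cancel_left _ hm]
  have hmod : b ^ j ≡ 1 [MOD d * ∑ t ∈ Finset.range j, b ^ t] :=
    ((Nat.modEq_iff_dvd' (Nat.one_le_pow _ _ (by omega))).mpr
      (hgeom ▸ Nat.dvd_mul_left _ _)).symm
  have hle := mul_le_digits_sum_mul_sum_pow hb hmod
    (mul_ne_zero (by omega) (mul_ne_zero hd0 hR.ne')) (Nat.dvd_mul_left _ k)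
  rw [← mul_assoc] at hle
  rw [digits_mul_sum_pow j hd0 hdb, List.sum_replicate, smul_eq_mul]
  exact Nat.le_of_mul_le_mul_right hle hR
end

section
/- Let b ≥ 2 and let r, e be positive integers. Then the number n = (b^{r·e} − 1)/(b^e − 1) is sturdy in base b. -/
theorem digits_sum_eq_mod_add_div {b : ℕ} (hb : 2 ≤ b) (x : ℕ) :
    (Nat.digits b x).sum = x % b + (Nat.digits b (x / b)).sum := by
  rcases Nat.eq_zero_or_pos x with rfl | hx
  · simp
  · rw [Nat.digits_def' (by omega) hx, List.sum_cons]

theorem digits_sum_add_mul {b : ℕ} (hb : 2 ≤ b) {d : ℕ} (hd : d < b) (x : ℕ) :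
    (Nat.digits b (d + b * x)).sum = d + (Nat.digits b x).sum := by
  rw [digits_sum_eq_mod_add_div hb, Nat.add_mul_mod_self_left, Nat.mod_eq_of_lt hd,
    Nat.add_mul_div_left _ _ (by omega), Nat.div_eq_of_lt hd, zero_add]

theorem digits_sum_succ_le {b : ℕ} (hb : 2 ≤ b) (x : ℕ) :
    (Nat.digits b (x + 1)).sum ≤ (Nat.digits b x).sum + 1 := by
  induction x using Nat.strong_induction_on with
  | _ x ih =>
    have hx := Nat.mod_add_div x b
    have hm := Nat.mod_lt x (show 0 < b by omega)
    rw [digits_sum_eq_mod_add_div hb x]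
    by_cases h : x % b + 1 < b
    · have h1 := digits_sum_add_mul hb h (x / b)
      rw [show x % b + 1 + b * (x / b) = x + 1 by omega] at h1
      omega
    · have h1 := digits_sum_add_mul hb (show 0 < b by omega) (x / b + 1)
      rw [show 0 + b * (x / b + 1) = x + 1 by rw [mul_add]; omega] at h1
      have h2 := ih (x / b) (Nat.div_lt_self (by omega) (by omega))
      omega

theorem digits_sum_add_le {b : ℕ} (hb : 2 ≤ b) (x y : ℕ) :
    (Nat.digits b (x + y)).sum ≤ (Nat.digits b x).sum + (Nat.digits b y).sum := by
  have small : ∀ d z, (Nat.digits b (z + d)).sum ≤ (Nat.digits b z).sum + d := by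
    intro d z
    induction d with
    | zero => simp
    | succ d ih =>
      have := digits_sum_succ_le hb (z + d)
      rw [← add_assoc]
      omega
  induction x using Nat.strong_induction_on generalizing y with
  | _ x ih =>
    rcases Nat.eq_zero_or_pos x with rfl | hx
    · simp
    have h1 := small (x % b) (b * (x / b) + y)
    have h2 := digits_sum_add_mul hb (Nat.mod_lt y (show 0 < b by omega)) (x / b + y / b)
    have h3 := ih (x / b) (Nat.div_lt_self hx (by omega)) (y / b)
    have hxx := Nat.mod_add_div x b
    have hyy := Nat.mod_add_div y b
    rw [show y % b + b * (x / b + y / b) = b * (x / b) + y by rw [mul_add]; omega] at h2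
    rw [show b * (x / b) + y + x % b = x + y by omega] at h1
    rw [digits_sum_eq_mod_add_div hb x, digits_sum_eq_mod_add_div hb y]
    omega

theorem digits_sum_add_pow_mul {b : ℕ} (hb : 2 ≤ b) (e : ℕ) {d : ℕ} (hd : d < b ^ e) (x : ℕ) :
    (Nat.digits b (d + b ^ e * x)).sum = (Nat.digits b d).sum + (Nat.digits b x).sum := by
  induction e generalizing d with
  | zero =>
    obtain rfl : d = 0 := by simpa using hd
    simp
  | succ e ih =>
    have hdd := Nat.mod_add_div d b
    have hlt : d / b < b ^ e := Nat.div_lt_of_lt_mul (by rwa [← pow_succ'])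
    have h1 := digits_sum_add_mul hb (Nat.mod_lt d (show 0 < b by omega)) (d / b + b ^ e * x)
    rw [show d % b + b * (d / b + b ^ e * x) = d + b ^ (e + 1) * x by
      rw [mul_add, pow_succ', mul_assoc]; omega] at h1
    rw [h1, ih hlt, digits_sum_eq_mod_add_div hb d]
    omega

theorem digits_sum_mul_geom_sum {b : ℕ} (hb : 2 ≤ b) (e r : ℕ) {j : ℕ} (hj : j < b ^ e) :
    (Nat.digits b (j * ∑ i ∈ Finset.range r, (b ^ e) ^ i)).sum = r * (Nat.digits b j).sum := by
  induction r with
  | zero => simp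
  | succ r ih =>
    rw [geom_sum_succ, show ∀ s, j * (b ^ e * s + 1) = j + b ^ e * (j * s) by intro s; ring,
      digits_sum_add_pow_mul hb e hj, ih]
    ring

theorem digits_sum_pos {b n : ℕ} (hn : 0 < n) : 0 < (Nat.digits b n).sum := by
  have h := List.getLast_mem (Nat.digits_ne_nil_iff_ne_zero.mpr hn.ne' : Nat.digits b n ≠ [])
  exact (Nat.pos_of_ne_zero (Nat.getLast_digit_ne_zero b hn.ne')).trans_le
    (List.single_le_sum (by simp) _ h)

theorem le_digits_sum_of_geom_sum_dvd {b e r : ℕ} (hb : 2 ≤ b) (hr : 1 ≤ r) (he : 1 ≤ e) {m : ℕ}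
    (hm : 0 < m) (hdvd : ∑ i ∈ Finset.range r, (b ^ e) ^ i ∣ m) :
    r ≤ (Nat.digits b m).sum := by
  have hB : 2 ≤ b ^ e := hb.trans (Nat.le_self_pow (by omega) b)
  have hgeom := geom_sum_mul_add (b ^ e - 1) r
  simp only [Nat.sub_add_cancel (show 1 ≤ b ^ e by omega)] at hgeom
  rw [← pow_mul] at hgeom
  have hN : 2 ≤ b ^ (e * r) := hb.trans (Nat.le_self_pow (Nat.mul_pos he hr).ne' b)
  induction m using Nat.strong_induction_on with
  | _ m ih =>
    by_cases hlt : m < b ^ (e * r)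
    · obtain ⟨j, rfl⟩ := hdvd
      have hj : j < b ^ e := by
        by_contra! h
        have h1 := Nat.mul_le_mul_left (∑ i ∈ Finset.range r, (b ^ e) ^ i) h
        have hpos := Nat.pos_of_mul_pos_right hm
        rw [← Nat.sub_add_cancel (show 1 ≤ b ^ e by omega), mul_add] at h1
        simp only [Nat.sub_add_cancel (show 1 ≤ b ^ e by omega)] at h1
        omega
      have hj0 : 0 < j := Nat.pos_of_mul_pos_left hm
      rw [mul_comm, digits_sum_mul_geom_sum hb e r hj]
      exact Nat.le_mul_of_pos_right _ (digits_sum_pos hj0)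
    · set N := b ^ (e * r) with hNdef
      have hsplit := Nat.mod_add_div m N
      have hq : 0 < m / N := Nat.div_pos (by omega) (by omega)
      have hqN : N * (m / N) = (N - 1) * (m / N) + m / N := by
        nth_rewrite 1 [show N = N - 1 + 1 by omega]
        ring
      have hpos : 0 < (N - 1) * (m / N) := Nat.mul_pos (by omega) hq
      have hdvd' : ∑ i ∈ Finset.range r, (b ^ e) ^ i ∣ m % N + m / N := by
        have h1 : ∑ i ∈ Finset.range r, (b ^ e) ^ i ∣ (N - 1) * (m / N) :=
          Dvd.dvd.mul_right ⟨b ^ e - 1, by omega⟩ _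
        rw [← Nat.dvd_add_right h1]
        rwa [show (N - 1) * (m / N) + (m % N + m / N) = m by omega]
      have h1 := ih (m % N + m / N) (by omega) (by omega) hdvd'
      have h2 := digits_sum_add_le hb (m % N) (m / N)
      have h3 := digits_sum_add_pow_mul hb (e * r) (Nat.mod_lt m (by omega : 0 < N)) (m / N)
      rw [← hNdef, hsplit] at h3
      omega

theorem stmt_6 (b r e : ℕ) (hb : 2 ≤ b) (hr : 1 ≤ r) (he : 1 ≤ e) :
    ∀ k : ℕ, 1 ≤ k →
      (Nat.digits b ((b ^ (r * e) - 1) / (b ^ e - 1))).sum ≤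
        (Nat.digits b (k * ((b ^ (r * e) - 1) / (b ^ e - 1)))).sum := by
  intro k hk
  have hB : 2 ≤ b ^ e := hb.trans (Nat.le_self_pow (by omega) b)
  have hgeom : (b ^ (r * e) - 1) / (b ^ e - 1) = ∑ i ∈ Finset.range r, (b ^ e) ^ i := by
    rw [Nat.geomSum_eq hB, ← pow_mul, mul_comm e r]
  rw [hgeom]
  have hpos : 0 < ∑ i ∈ Finset.range r, (b ^ e) ^ i :=
    Finset.sum_pos (fun _ _ => by positivity) ⟨0, Finset.mem_range.mpr hr⟩
  have hone := digits_sum_mul_geom_sum hb e r (show 1 < b ^ e by omega)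
  rw [one_mul, Nat.digits_of_lt b 1 one_ne_zero (by omega), List.sum_singleton, mul_one] at hone
  rw [hone]
  exact le_digits_sum_of_geom_sum_dvd hb hr he (Nat.mul_pos hk hpos) (Dvd.intro_left k rfl)
end

section
/- Let r and e be positive integers. Then the number (2^{2·r·e} − 1)/(2^e + 1) is sturdy in base 2. (This is the number whose binary representation is (1^e 0^e)^{r−1} 1^e.) -/
theorem digits_two_sum_eq (n : ℕ) :
    (Nat.digits 2 n).sum = n % 2 + (Nat.digits 2 (n / 2)).sum := by
  rcases Nat.eq_zero_or_pos n with rfl | h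
  · simp
  · rw [Nat.digits_def' (by norm_num) h, List.sum_cons]

theorem digits_two_sum_add_le (a b : ℕ) :
    (Nat.digits 2 (a + b)).sum ≤ (Nat.digits 2 a).sum + (Nat.digits 2 b).sum := by
  induction h : a + b using Nat.strong_induction_on generalizing a b with
  | _ n ih =>
    subst h
    rcases Nat.eq_zero_or_pos (a + b) with h0 | h0
    · simp [h0]
    have hab := digits_two_sum_eq (a + b)
    have ha := digits_two_sum_eq a
    have hb := digits_two_sum_eq b
    by_cases hodd : a % 2 = 1 ∧ b % 2 = 1
    · have h1 := ih _ (by omega) (a / 2) (b / 2 + 1) rfl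
      have h2 := ih _ (by omega) (b / 2) 1 rfl
      have h3 : (Nat.digits 2 1).sum = 1 := by simp
      rw [show (a + b) / 2 = a / 2 + (b / 2 + 1) by omega] at hab
      omega
    · have h1 := ih _ (by omega) (a / 2) (b / 2) rfl
      rw [show (a + b) / 2 = a / 2 + b / 2 by omega] at hab
      omega

theorem digits_two_sum_mul_two_pow_add (m a b : ℕ) (hb : b < 2 ^ m) :
    (Nat.digits 2 (a * 2 ^ m + b)).sum = (Nat.digits 2 a).sum + (Nat.digits 2 b).sum := by
  induction m generalizing b with
  | zero =>
    obtain rfl : b = 0 := by simpa using hb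
    simp
  | succ m ih =>
    rw [pow_succ] at hb
    rw [digits_two_sum_eq, digits_two_sum_eq b, pow_succ, ← mul_assoc]
    rw [show (a * 2 ^ m * 2 + b) % 2 = b % 2 by omega,
      show (a * 2 ^ m * 2 + b) / 2 = a * 2 ^ m + b / 2 by omega, ih _ (by omega)]
    omega

theorem digits_two_sum_two_pow_sub_one (m : ℕ) : (Nat.digits 2 (2 ^ m - 1)).sum = m := by
  induction m with
  | zero => simp
  | succ m ih =>
    have := Nat.two_pow_pos m
    rw [digits_two_sum_eq, pow_succ, show (2 ^ m * 2 - 1) / 2 = 2 ^ m - 1 by omega, ih]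
    omega

theorem digits_two_sum_mul_geom_sum (m c r : ℕ) (hc : c < 2 ^ m) :
    (Nat.digits 2 (c * ∑ i ∈ Finset.range r, (2 ^ m) ^ i)).sum = r * (Nat.digits 2 c).sum := by
  induction r with
  | zero => simp
  | succ r ih =>
    have h : c * ∑ i ∈ Finset.range (r + 1), (2 ^ m) ^ i =
        (c * ∑ i ∈ Finset.range r, (2 ^ m) ^ i) * 2 ^ m + c := by
      rw [geom_sum_succ]
      ring
    rw [h, digits_two_sum_mul_two_pow_add _ _ _ hc, ih]
    ring

/-- Folding the binary expansion modulo `2 ^ N - 1` does not increase the digit sum, so it suffices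
to bound the digit sums of the multiples of a divisor `n` of `2 ^ N - 1` up to `2 ^ N - 1`. -/
theorem le_digits_two_sum_mul {N n q w : ℕ} (hq : q * n + 1 = 2 ^ N) (hN : 0 < N)
    (h : ∀ k, 1 ≤ k → k ≤ q → w ≤ (Nat.digits 2 (k * n)).sum) (k : ℕ) (hk : 1 ≤ k) :
    w ≤ (Nat.digits 2 (k * n)).sum := by
  have hN2 : 2 ≤ 2 ^ N := by
    simpa using Nat.pow_le_pow_right (n := 2) (by norm_num) hN
  have hn : 0 < n := Nat.pos_of_ne_zero (by rintro rfl; simp at hq; omega)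
  induction k using Nat.strong_induction_on with
  | _ k ih =>
    by_cases hkq : k ≤ q
    · exact h k hk hkq
    have hlt : 2 ^ N ≤ k * n := by nlinarith
    set a := k * n / 2 ^ N with ha
    set b := k * n % 2 ^ N with hb
    have hdiv : a * 2 ^ N + b = k * n := by rw [ha, hb, mul_comm]; exact Nat.div_add_mod _ _
    have ha1 : 1 ≤ a := (Nat.one_le_div_iff (by omega)).2 hlt
    have hqpos : 0 < q := Nat.pos_of_ne_zero (by rintro rfl; simp at hq; omega)
    have hfold : a * q * n + (a + b) = k * n := by rw [← hdiv, ← hq]; ring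
    have hak : a * q < k := by
      by_contra! hc
      nlinarith [Nat.mul_le_mul_right n hc]
    have heq : (k - a * q) * n = a + b := by rw [Nat.sub_mul]; omega
    have haq : 0 < a * q := Nat.mul_pos ha1 hqpos
    have := ih (k - a * q) (by omega) (by omega)
    rw [heq] at this
    rw [← hdiv, digits_two_sum_mul_two_pow_add N a b (Nat.mod_lt _ (by omega))]
    exact this.trans (digits_two_sum_add_le a b)

theorem le_digits_two_sum_mul_two_pow_sub_one (e k : ℕ) (he : 1 ≤ e) (hk : 1 ≤ k) :
    e ≤ (Nat.digits 2 (k * (2 ^ e - 1))).sum := by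
  have hpos := Nat.two_pow_pos e
  refine le_digits_two_sum_mul (N := e) (q := 1) (by omega) he (fun k h1 h2 => ?_) k hk
  rw [le_antisymm h2 h1, one_mul, digits_two_sum_two_pow_sub_one]

theorem stmt_9 (r e : ℕ) (hr : 1 ≤ r) (he : 1 ≤ e) :
    ∀ k : ℕ, 1 ≤ k →
      (Nat.digits 2 ((2 ^ (2 * r * e) - 1) / (2 ^ e + 1))).sum ≤
        (Nat.digits 2 (k * ((2 ^ (2 * r * e) - 1) / (2 ^ e + 1)))).sum := by
  have hpos := Nat.two_pow_pos e
  have hsq : (2 ^ e + 1) * (2 ^ e - 1) + 1 = 2 ^ (2 * e) := by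
    obtain ⟨t, ht⟩ := Nat.exists_eq_add_of_le' hpos
    rw [mul_comm 2 e, pow_mul, ht, Nat.add_sub_cancel]
    ring
  set S := ∑ i ∈ Finset.range r, (2 ^ (2 * e)) ^ i with hS
  have hgeom : (2 ^ e + 1) * ((2 ^ e - 1) * S) + 1 = 2 ^ (2 * r * e) := by
    have h := geom_sum_mul_add ((2 ^ e + 1) * (2 ^ e - 1)) r
    rw [hsq, ← hS, ← pow_mul] at h
    rw [show 2 * r * e = 2 * e * r by ring, ← h]
    ring
  have hn : (2 ^ (2 * r * e) - 1) / (2 ^ e + 1) = (2 ^ e - 1) * S := by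
    rw [← hgeom, Nat.add_sub_cancel, Nat.mul_div_cancel_left _ (by omega)]
  have hblock : ∀ k, k ≤ 2 ^ e + 1 → (Nat.digits 2 (k * ((2 ^ e - 1) * S))).sum =
      r * (Nat.digits 2 (k * (2 ^ e - 1))).sum := fun k hk => by
    rw [← mul_assoc, digits_two_sum_mul_geom_sum]
    have := Nat.mul_le_mul_right (2 ^ e - 1) hk
    omega
  have hsum : (Nat.digits 2 ((2 ^ e - 1) * S)).sum = r * e := by
    simpa [digits_two_sum_two_pow_sub_one] using hblock 1 (by omega)
  rw [hn, hsum]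
  refine le_digits_two_sum_mul hgeom (by positivity) fun k h1 h2 => ?_
  rw [hblock k h2]
  exact Nat.mul_le_mul_left r (le_digits_two_sum_mul_two_pow_sub_one e k he h1)
end

section
/- Let b ≥ 2 and n ≥ 1 be integers, and let e_1, e_2, …, e_m be the distinct elements of the set P = {b^i mod n : i ∈ ℕ}. Suppose there exist nonnegative integers a_1, …, a_m with a_1·e_1 + ⋯ + a_m·e_m ≡ 0 (mod n) and a_1 + ⋯ + a_m = k ≥ 1. Then there exist nonnegative integers c_1, …, c_m, each satisfying c_i < b, such that c_1·e_1 + ⋯ + c_m·e_m ≡ 0 (mod n) and 1 ≤ c_1 + ⋯ + c_m ≤ k. -/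
theorem stmt_10 (b n : ℕ) (hb : 2 ≤ b) (hn : 1 ≤ n)
    (P : Finset ℕ) (hP : ∀ x : ℕ, x ∈ P ↔ ∃ i : ℕ, b ^ i % n = x)
    (a : ℕ → ℕ) (k : ℕ) (hk : 1 ≤ k)
    (hsum : (∑ e ∈ P, a e * e) % n = 0)
    (hcount : ∑ e ∈ P, a e = k) :
    ∃ c : ℕ → ℕ, (∀ e ∈ P, c e < b) ∧
      (∑ e ∈ P, c e * e) % n = 0 ∧
      1 ≤ ∑ e ∈ P, c e ∧ ∑ e ∈ P, c e ≤ k := by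
  induction k using Nat.strong_induction_on generalizing a with
  | _ k ih =>
  by_cases hsmall : ∀ e ∈ P, a e < b
  · exact ⟨a, hsmall, hsum, hcount ▸ hk, hcount.le⟩
  push Not at hsmall
  obtain ⟨e, he, hbe⟩ := hsmall
  have hf : b * e % n ∈ P := by
    obtain ⟨i, rfl⟩ := (hP e).1 he
    exact (hP _).2 ⟨i + 1, by rw [pow_succ', Nat.mul_mod_mod]⟩
  -- Trade `b` copies of `e` for a single copy of `b * e % n`.
  obtain ⟨r, rfl⟩ : ∃ r : ℕ → ℕ, a = fun x => r x + if x = e then b else 0 := by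
    refine ⟨fun x => a x - if x = e then b else 0, funext fun x => ?_⟩
    by_cases hx : x = e
    · subst hx
      simp [Nat.sub_add_cancel hbe]
    · simp [hx]
  simp only [add_mul, ite_mul, zero_mul, Finset.sum_add_distrib, Finset.sum_ite_eq', he,
    if_true] at hsum hcount
  obtain ⟨c, hcb, hc0, hc1, hck⟩ := ih (∑ x ∈ P, r x + 1) (by omega)
    (fun x => r x + if x = b * e % n then 1 else 0) (by omega)
    (by
      simp only [add_mul, ite_mul, zero_mul, one_mul, Finset.sum_add_distrib,
        Finset.sum_ite_eq', hf, if_true]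
      rwa [Nat.add_mod_mod])
    (by simp only [Finset.sum_add_distrib, Finset.sum_ite_eq', hf, if_true])
  exact ⟨c, hcb, hc0, hc1, by omega⟩
end

section
/- Let n be an odd positive integer whose binary representation contains exactly one 0 (i.e., the list Nat.digits 2 n contains exactly one entry equal to 0). Then n is sturdy in base 2 if and only if n = 5; equivalently, every such n other than 5 is flimsy in base 2, and 5 is sturdy in base 2. -/
/-- The binary digit sum does not change under doubling. -/
theorem sum_digits_two_mul (n : ℕ) : (Nat.digits 2 (2 * n)).sum = (Nat.digits 2 n).sum := by
  rcases Nat.eq_zero_or_pos n with rfl | h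
  · simp
  · rw [Nat.digits_def' (by norm_num) (by omega)]
    simp

theorem digits_two_mul_add_one (n : ℕ) :
    Nat.digits 2 (2 * n + 1) = 1 :: Nat.digits 2 n := by
  rw [Nat.digits_def' (by norm_num) (by omega), show (2 * n + 1) % 2 = 1 by omega,
    show (2 * n + 1) / 2 = n by omega]

theorem sum_digits_two_mul_add_one (n : ℕ) :
    (Nat.digits 2 (2 * n + 1)).sum = (Nat.digits 2 n).sum + 1 := by
  rw [digits_two_mul_add_one, List.sum_cons, add_comm]

/-- Binary digit sums add when the binary blocks do not overlap. -/
theorem sum_digits_two_pow_mul_add (k x y : ℕ) (hy : y < 2 ^ k) :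
    (Nat.digits 2 (2 ^ k * x + y)).sum = (Nat.digits 2 x).sum + (Nat.digits 2 y).sum := by
  induction k generalizing y with
  | zero =>
    obtain rfl : y = 0 := by simpa using hy
    simp
  | succ k ih =>
    rw [pow_succ] at hy
    obtain ⟨z, rfl | rfl⟩ : ∃ z, y = 2 * z ∨ y = 2 * z + 1 := ⟨y / 2, by omega⟩
    · rw [show 2 ^ (k + 1) * x + 2 * z = 2 * (2 ^ k * x + z) by ring, sum_digits_two_mul,
        sum_digits_two_mul, ih z (by omega)]
    · rw [show 2 ^ (k + 1) * x + (2 * z + 1) = 2 * (2 ^ k * x + z) + 1 by ring,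
        sum_digits_two_mul_add_one, sum_digits_two_mul_add_one, ih z (by omega), add_assoc]

theorem sum_digits_of_add_one_eq_two_pow {k n : ℕ} (h : n + 1 = 2 ^ k) :
    (Nat.digits 2 n).sum = k := by
  induction k generalizing n with
  | zero =>
    obtain rfl : n = 0 := by simpa using h
    simp
  | succ k ih =>
    rw [pow_succ] at h
    have hpos : 0 < 2 ^ k := by positivity
    obtain ⟨z, rfl⟩ : ∃ z, n = 2 * z + 1 := ⟨n / 2, by omega⟩
    rw [sum_digits_two_mul_add_one, ih (by omega)]

/-- A number without zero binary digits is one less than a power of two. -/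
theorem exists_add_one_eq_two_pow (n : ℕ) (h : (Nat.digits 2 n).count 0 = 0) :
    ∃ k, n + 1 = 2 ^ k := by
  induction n using Nat.strong_induction_on with
  | _ n ih =>
    rcases Nat.eq_zero_or_pos n with rfl | hn
    · exact ⟨0, rfl⟩
    obtain ⟨z, rfl | rfl⟩ : ∃ z, n = 2 * z ∨ n = 2 * z + 1 := ⟨n / 2, by omega⟩
    · rw [Nat.digits_def' (by norm_num) hn] at h
      simp at h
    · rw [digits_two_mul_add_one, List.count_cons] at h
      obtain ⟨k, hk⟩ := ih z (by omega) (by simpa using h)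
      exact ⟨k + 1, by rw [pow_succ]; omega⟩

/-- The shape of a number with exactly one zero binary digit, at position `b`. -/
theorem exists_add_one_add_two_pow_eq (n : ℕ) (h : (Nat.digits 2 n).count 0 = 1) :
    ∃ a b, 1 ≤ a ∧ n + 1 + 2 ^ b = 2 ^ (a + b + 1) ∧ (Nat.digits 2 n).sum = a + b := by
  induction n using Nat.strong_induction_on with
  | _ n ih =>
    rcases Nat.eq_zero_or_pos n with rfl | hn
    · simp at h
    obtain ⟨z, rfl | rfl⟩ : ∃ z, n = 2 * z ∨ n = 2 * z + 1 := ⟨n / 2, by omega⟩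
    · rw [Nat.digits_def' (by norm_num) hn] at h
      obtain ⟨k, hk⟩ := exists_add_one_eq_two_pow z (by simpa using h)
      refine ⟨k, 0, ?_, ?_, ?_⟩
      · rcases k with _ | k
        · simp at hk
          omega
        · omega
      · rw [add_zero, pow_succ, pow_zero]
        omega
      · rw [sum_digits_two_mul, sum_digits_of_add_one_eq_two_pow hk, add_zero]
    · rw [digits_two_mul_add_one, List.count_cons] at h
      obtain ⟨a, b, ha, hab, hs⟩ := ih z (by omega) (by simpa using h)
      refine ⟨a, b + 1, ha, ?_, ?_⟩
      · rw [← add_assoc, pow_succ 2 (a + b + 1), ← hab, pow_succ]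
        ring
      · rw [sum_digits_two_mul_add_one, hs, add_assoc]

theorem sum_digits_two_pos {n : ℕ} (hn : 0 < n) : 0 < (Nat.digits 2 n).sum := by
  induction n using Nat.strong_induction_on with
  | _ n ih =>
    obtain ⟨z, rfl | rfl⟩ : ∃ z, n = 2 * z ∨ n = 2 * z + 1 := ⟨n / 2, by omega⟩
    · rw [sum_digits_two_mul]
      exact ih z (by omega) (by omega)
    · rw [sum_digits_two_mul_add_one]
      omega

/-- No positive multiple of five is a power of two. -/
theorem two_le_sum_digits_of_five_dvd {n : ℕ} (hn : 0 < n) (h : 5 ∣ n) :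
    2 ≤ (Nat.digits 2 n).sum := by
  induction n using Nat.strong_induction_on with
  | _ n ih =>
    obtain ⟨z, rfl | rfl⟩ : ∃ z, n = 2 * z ∨ n = 2 * z + 1 := ⟨n / 2, by omega⟩
    · rw [sum_digits_two_mul]
      exact ih z (by omega) (by omega) (by omega)
    · rw [sum_digits_two_mul_add_one]
      have := sum_digits_two_pos (n := z) (by omega)
      omega

/-- Multiplication by three when the zero digit is at position at least two. -/
theorem sum_digits_three_mul {c d n : ℕ} (h : n + 1 + 2 ^ (c + 2) = 2 ^ (d + c + 4)) :
    (Nat.digits 2 (3 * n)).sum = c + d + 2 := by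
  obtain ⟨C, hC⟩ : ∃ C, C + 1 = 2 ^ c := ⟨2 ^ c - 1, Nat.sub_add_cancel Nat.one_le_two_pow⟩
  obtain ⟨D, hD⟩ : ∃ D, D + 1 = 2 ^ d := ⟨2 ^ d - 1, Nat.sub_add_cancel Nat.one_le_two_pow⟩
  have key : 3 * n = 2 ^ (c + 4) * (2 ^ (d + 1) * 1 + D) + (2 * (2 * C) + 1) := by
    simp only [pow_add, ← hC, ← hD] at h ⊢
    nlinarith
  rw [key, sum_digits_two_pow_mul_add _ _ _ (by rw [pow_add]; omega),
    sum_digits_two_pow_mul_add _ _ _ (by rw [pow_succ]; omega),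
    sum_digits_two_mul_add_one, sum_digits_two_mul,
    sum_digits_of_add_one_eq_two_pow hC, sum_digits_of_add_one_eq_two_pow hD]
  norm_num
  ring

/-- Multiplication by five when the zero digit is at position one. -/
theorem sum_digits_five_mul {e n : ℕ} (h : n + 3 = 2 ^ (e + 4)) :
    (Nat.digits 2 (5 * n)).sum = e + 2 := by
  obtain ⟨E, hE⟩ : ∃ E, E + 1 = 2 ^ e := ⟨2 ^ e - 1, Nat.sub_add_cancel Nat.one_le_two_pow⟩
  have key : 5 * n = 2 ^ (e + 4) * 4 + (2 ^ 4 * E + 1) := by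
    simp only [pow_add, ← hE] at h ⊢
    omega
  rw [key, sum_digits_two_pow_mul_add _ _ _ (by rw [pow_add]; omega),
    sum_digits_two_pow_mul_add _ _ _ (by norm_num), sum_digits_of_add_one_eq_two_pow hE]
  norm_num
  ring

theorem stmt_11 (n : ℕ) (hn : 0 < n) (hodd : Odd n)
    (h0 : (Nat.digits 2 n).count 0 = 1) :
    (∀ k : ℕ, 1 ≤ k → (Nat.digits 2 n).sum ≤ (Nat.digits 2 (k * n)).sum) ↔
      n = 5 := by
  constructor
  · intro hk
    obtain ⟨a, b, ha, hab, hs⟩ := exists_add_one_add_two_pow_eq n h0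
    obtain ⟨d, rfl⟩ := Nat.exists_eq_add_of_le' ha
    obtain ⟨t, rfl⟩ := hodd
    rcases b with _ | _ | c
    · rw [add_zero, pow_succ, pow_zero] at hab
      omega
    · rcases d with _ | e
      · norm_num at hab
        omega
      · have h5 := hk 5 (by norm_num)
        rw [hs, sum_digits_five_mul (e := e) (by
          rw [show e + 4 = e + 1 + 1 + (0 + 1) + 1 by ring, ← hab]
          norm_num)] at h5
        omega
    · have h3 := hk 3 (by norm_num)
      rw [hs, sum_digits_three_mul (c := c) (d := d) (by
        rw [show d + c + 4 = d + 1 + (c + 1 + 1) + 1 by ring, ← hab])] at h3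
      omega
  · rintro rfl k hk
    have h := two_le_sum_digits_of_five_dvd (n := k * 5) (by omega) (by omega)
    simpa using h
end

section
/- Let n be an odd positive integer whose binary representation contains exactly three 0's (i.e., the list Nat.digits 2 n contains exactly three entries equal to 0). Then n is sturdy in base 2 if and only if n ∈ {17, 85, 89, 455}, or n = 2^{i+5} + 2^{i+3} − 5 for some integer i ≥ 0 (binary representation 1 0 0 1^i 0 1 1), or n = 2^{i+5} + 2^{i+4} + 2^{i+3} − 7 for some integer i ≥ 0 (binary representation 1 1 0 1^i 0 0 1); every other such n is flimsy in base 2. -/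
/-- The sum of the binary digits of `n`. -/
def bitSum (n : ℕ) : ℕ := (Nat.digits 2 n).sum

theorem bitSum_bit (a b : ℕ) (hb : b < 2) : bitSum (2 * a + b) = b + bitSum a := by
  unfold bitSum
  rcases Nat.eq_zero_or_pos (2 * a + b) with h | h
  · obtain ⟨rfl, rfl⟩ : a = 0 ∧ b = 0 := by omega
    simp
  · rw [Nat.digits_def' (by norm_num) h, List.sum_cons]
    congr 2
    · omega
    · congr 1
      omega

theorem bitSum_two_mul (a : ℕ) : bitSum (2 * a) = bitSum a := by
  simpa using bitSum_bit a 0 (by norm_num)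

theorem bitSum_two_mul_add_one (a : ℕ) : bitSum (2 * a + 1) = 1 + bitSum a :=
  bitSum_bit a 1 (by norm_num)

theorem bitSum_two_pow_mul_add (j a b : ℕ) (hb : b < 2 ^ j) :
    bitSum (2 ^ j * a + b) = bitSum a + bitSum b := by
  induction j generalizing b with
  | zero =>
    obtain rfl : b = 0 := by simpa using hb
    simp [bitSum]
  | succ j ih =>
    have hb' : b / 2 < 2 ^ j := by rw [pow_succ] at hb; omega
    have h2 : b % 2 < 2 := Nat.mod_lt _ (by norm_num)
    have h1 : 2 ^ (j + 1) * a + b = 2 * (2 ^ j * a + b / 2) + b % 2 := by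
      conv_lhs => rw [← Nat.div_add_mod b 2]
      ring
    have h3 : bitSum b = b % 2 + bitSum (b / 2) := by
      conv_lhs => rw [← Nat.div_add_mod b 2]
      exact bitSum_bit _ _ h2
    rw [h1, bitSum_bit _ _ h2, ih _ hb', h3]
    ring

theorem bitSum_add_le (a b : ℕ) : bitSum (a + b) ≤ bitSum a + bitSum b := by
  have succ_le (n : ℕ) : bitSum (n + 1) ≤ bitSum n + 1 := by
    induction n using Nat.strong_induction_on with
    | _ n ih =>
      rcases Nat.even_or_odd' n with ⟨m, rfl | rfl⟩
      · rw [bitSum_two_mul_add_one, bitSum_two_mul]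
        omega
      · have := ih m (by omega)
        rw [show 2 * m + 1 + 1 = 2 * (m + 1) by ring, bitSum_two_mul, bitSum_two_mul_add_one]
        omega
  induction a using Nat.strong_induction_on generalizing b with
  | _ a ih =>
    rcases Nat.eq_zero_or_pos a with rfl | ha
    · simp
    rcases Nat.even_or_odd' a with ⟨m, rfl | rfl⟩ <;>
      rcases Nat.even_or_odd' b with ⟨l, rfl | rfl⟩ <;>
      have := ih m (by omega) l
    · rw [show 2 * m + 2 * l = 2 * (m + l) by ring]
      simpa only [bitSum_two_mul] using this
    · rw [show 2 * m + (2 * l + 1) = 2 * (m + l) + 1 by ring]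
      simp only [bitSum_two_mul, bitSum_two_mul_add_one]
      omega
    · rw [show 2 * m + 1 + 2 * l = 2 * (m + l) + 1 by ring]
      simp only [bitSum_two_mul, bitSum_two_mul_add_one]
      omega
    · have h := succ_le (m + l)
      rw [show 2 * m + 1 + (2 * l + 1) = 2 * (m + l + 1) by ring]
      simp only [bitSum_two_mul, bitSum_two_mul_add_one]
      omega

/-- If `n ∣ 2 ^ m - 1`, a lower bound for the digit sums of the multiples of `n` has to be checked
only up to `2 ^ m - 1`, since replacing `2 ^ m * a + b` by `a + b` does not increase digit sums. -/
theorem le_bitSum_of_dvd {n m t : ℕ} (hm : 0 < m) (hn : n ∣ 2 ^ m - 1)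
    (h : ∀ x, 0 < x → x < 2 ^ m → n ∣ x → t ≤ bitSum x) (x : ℕ) (hx : 0 < x) (hnx : n ∣ x) :
    t ≤ bitSum x := by
  induction x using Nat.strong_induction_on with
  | _ x ih =>
    rcases lt_or_ge x (2 ^ m) with hlt | hge
    · exact h x hx hlt hnx
    have hpow : 2 ≤ 2 ^ m := by
      simpa using Nat.pow_le_pow_right (show 0 < 2 by norm_num) hm
    have hdm := Nat.div_add_mod x (2 ^ m)
    have hmod : x % 2 ^ m < 2 ^ m := Nat.mod_lt _ (by positivity)
    have hdiv : 0 < x / 2 ^ m := Nat.div_pos hge (by positivity)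
    have hsplit : x = (2 ^ m - 1) * (x / 2 ^ m) + (x / 2 ^ m + x % 2 ^ m) := by
      rw [Nat.sub_mul]
      have : x / 2 ^ m ≤ 2 ^ m * (x / 2 ^ m) := Nat.le_mul_of_pos_left _ (by positivity)
      omega
    have hpos : 0 < (2 ^ m - 1) * (x / 2 ^ m) := Nat.mul_pos (by omega) hdiv
    have hdvd : n ∣ x / 2 ^ m + x % 2 ^ m := by
      rw [hsplit] at hnx
      exact (Nat.dvd_add_right (hn.mul_right _)).1 hnx
    calc t ≤ bitSum (x / 2 ^ m + x % 2 ^ m) := ih _ (by omega) (by omega) hdvd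
      _ ≤ bitSum (x / 2 ^ m) + bitSum (x % 2 ^ m) := bitSum_add_le _ _
      _ = bitSum x := by rw [← bitSum_two_pow_mul_add _ _ _ hmod, hdm]

/-- The number whose binary expansion is that of `x` followed by `t` ones. -/
def appendOnes (t x : ℕ) : ℕ := 2 ^ t * x + (2 ^ t - 1)

theorem appendOnes_zero (x : ℕ) : appendOnes 0 x = x := by simp [appendOnes]

theorem appendOnes_succ (t x : ℕ) : appendOnes (t + 1) x = 2 * appendOnes t x + 1 := by
  have : 0 < 2 ^ t := by positivity
  simp only [appendOnes, pow_succ, mul_add, mul_assoc, mul_left_comm 2]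
  omega

theorem appendOnes_succ' (t x : ℕ) : appendOnes (t + 1) x = appendOnes t (2 * x + 1) := by
  have : 0 < 2 ^ t := by positivity
  simp only [appendOnes, pow_succ, mul_add, mul_assoc]
  omega

theorem bitSum_appendOnes (t x : ℕ) : bitSum (appendOnes t x) = t + bitSum x := by
  induction t with
  | zero => simp [appendOnes_zero]
  | succ t ih => rw [appendOnes_succ, bitSum_two_mul_add_one, ih]; ring

/-- The number with binary expansion `1^p 0 1^q 0 1^r 0 1^t`. -/
def threeZeros (p q r t : ℕ) : ℕ :=
  appendOnes t (2 * appendOnes r (2 * appendOnes q (2 * appendOnes p 0)))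

theorem exists_eq_appendOnes_two_mul {n z : ℕ} (h : (Nat.digits 2 n).count 0 = z + 1) :
    ∃ t x, n = appendOnes t (2 * x) ∧ (Nat.digits 2 x).count 0 = z := by
  induction n using Nat.strong_induction_on with
  | _ n ih =>
    rcases Nat.eq_zero_or_pos n with rfl | hn
    · simp at h
    rw [Nat.digits_def' (by norm_num) hn] at h
    rcases Nat.even_or_odd' n with ⟨m, rfl | rfl⟩
    · refine ⟨0, m, (appendOnes_zero _).symm, ?_⟩
      simpa using h
    · have h1 : (2 * m + 1) / 2 = m := by omega
      have h2 : (2 * m + 1) % 2 = 1 := by omega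
      rw [h1, h2, List.count_cons_of_ne (by norm_num)] at h
      obtain ⟨t, x, hm, hx⟩ := ih m (by omega) h
      exact ⟨t + 1, x, by rw [appendOnes_succ, ← hm], hx⟩

theorem exists_eq_appendOnes_zero {n : ℕ} (h : (Nat.digits 2 n).count 0 = 0) :
    ∃ p, n = appendOnes p 0 := by
  induction n using Nat.strong_induction_on with
  | _ n ih =>
    rcases Nat.eq_zero_or_pos n with rfl | hn
    · exact ⟨0, rfl⟩
    rw [Nat.digits_def' (by norm_num) hn] at h
    rcases Nat.even_or_odd' n with ⟨m, rfl | rfl⟩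
    · simp at h
    · have h1 : (2 * m + 1) / 2 = m := by omega
      have h2 : (2 * m + 1) % 2 = 1 := by omega
      rw [h1, h2, List.count_cons_of_ne (by norm_num)] at h
      obtain ⟨p, hm⟩ := ih m (by omega) h
      exact ⟨p + 1, by rw [appendOnes_succ, ← hm]⟩

theorem exists_eq_threeZeros {n : ℕ} (hodd : Odd n) (h0 : (Nat.digits 2 n).count 0 = 3) :
    ∃ p q r t, 1 ≤ p ∧ 1 ≤ t ∧ n = threeZeros p q r t := by
  obtain ⟨t, x, rfl, hx⟩ := exists_eq_appendOnes_two_mul h0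
  obtain ⟨r, y, rfl, hy⟩ := exists_eq_appendOnes_two_mul hx
  obtain ⟨q, z, rfl, hz⟩ := exists_eq_appendOnes_two_mul hy
  obtain ⟨p, rfl⟩ := exists_eq_appendOnes_zero hz
  refine ⟨p, q, r, t, ?_, ?_, rfl⟩
  · by_contra hp
    obtain rfl : p = 0 := by omega
    have hq : ∀ q, (Nat.digits 2 (appendOnes q 0)).count 0 = 0 := by
      intro q
      induction q with
      | zero => simp [appendOnes_zero]
      | succ q ih =>
        rw [appendOnes_succ, Nat.digits_def' (by norm_num) (by omega)]
        have h1 : (2 * appendOnes q 0 + 1) / 2 = appendOnes q 0 := by omega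
        have h2 : (2 * appendOnes q 0 + 1) % 2 = 1 := by omega
        rw [h1, h2, List.count_cons_of_ne (by norm_num), ih]
    simp [appendOnes_zero, hq] at hy
  · by_contra ht
    obtain rfl : t = 0 := by omega
    rw [appendOnes_zero] at hodd
    exact (Nat.not_odd_iff_even.2 (even_two_mul _)) hodd

/-- For every multiplier `k ≤ 32` and every carry `c < k`, the digit sums of `k * x + c` and
`k * y + c` differ by `e`. -/
def DigitShift (e x y : ℕ) : Prop :=
  ∀ k c, c < k → k ≤ 32 → bitSum (k * x + c) = e + bitSum (k * y + c)

theorem DigitShift.refl (x : ℕ) : DigitShift 0 x x := fun _ _ _ _ => (zero_add _).symm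

theorem DigitShift.trans {e f x y z : ℕ} (h : DigitShift e x y) (h' : DigitShift f y z) :
    DigitShift (e + f) x z := fun k c hc hk => by
  rw [h k c hc hk, h' k c hc hk, add_assoc]

theorem DigitShift.two_pow_mul_add {e x y : ℕ} (h : DigitShift e x y) {j u : ℕ} (hu : u < 2 ^ j) :
    DigitShift e (2 ^ j * x + u) (2 ^ j * y + u) := fun k c hc hk => by
  have key (x : ℕ) : bitSum (k * (2 ^ j * x + u) + c) =
      bitSum (k * x + (k * u + c) / 2 ^ j) + bitSum ((k * u + c) % 2 ^ j) := by
    rw [← bitSum_two_pow_mul_add j _ _ (Nat.mod_lt _ (by positivity))]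
    congr 1
    have := Nat.div_add_mod (k * u + c) (2 ^ j)
    linear_combination -this
  have hcarry : (k * u + c) / 2 ^ j < k := by
    rw [Nat.div_lt_iff_lt_mul (by positivity)]
    nlinarith
  rw [key, key, h k _ hcarry hk, add_assoc]

theorem DigitShift.two_mul {e x y : ℕ} (h : DigitShift e x y) :
    DigitShift e (2 * x) (2 * y) := by
  simpa using h.two_pow_mul_add (j := 1) (u := 0) (by norm_num)

theorem DigitShift.appendOnes {e x y : ℕ} (h : DigitShift e x y) (t : ℕ) :
    DigitShift e (appendOnes t x) (appendOnes t y) :=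
  h.two_pow_mul_add (Nat.sub_lt (by positivity) one_pos)

theorem digitShift_appendOnes_succ {t : ℕ} (ht : 5 ≤ t) (x : ℕ) :
    DigitShift 1 (appendOnes (t + 1) x) (appendOnes t x) := fun k c hc hk => by
  have h32 : 32 ≤ 2 ^ t := by
    simpa using Nat.pow_le_pow_right (show 0 < 2 by norm_num) ht
  have key (x : ℕ) : bitSum (k * _root_.appendOnes t x + c) =
      bitSum (k * x + (k - 1)) + bitSum (2 ^ t - k + c) := by
    rw [← bitSum_two_pow_mul_add t _ _ (by omega)]
    congr 1
    unfold _root_.appendOnes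
    zify [show k ≤ 2 ^ t by omega, show 1 ≤ 2 ^ t by omega, show 1 ≤ k by omega]
    ring
  have hstep : k * (2 * x + 1) + (k - 1) = 2 * (k * x + (k - 1)) + 1 := by
    rw [mul_add, mul_left_comm]
    omega
  rw [appendOnes_succ', key, key, hstep, bitSum_two_mul_add_one, add_assoc]

theorem exists_digitShift_appendOnes_min (t x : ℕ) :
    ∃ e, DigitShift e (appendOnes t x) (appendOnes (min t 5) x) := by
  induction t with
  | zero => exact ⟨0, .refl _⟩
  | succ t ih =>
    rcases lt_or_ge t 5 with ht | ht
    · rw [min_eq_left (by omega)]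
      exact ⟨0, .refl _⟩
    · obtain ⟨e, he⟩ := ih
      rw [min_eq_right ht] at he
      rw [min_eq_right (by omega)]
      exact ⟨_, (digitShift_appendOnes_succ ht x).trans he⟩

theorem exists_digitShift_threeZeros_min (p q r t : ℕ) :
    ∃ e, DigitShift e (threeZeros p q r t)
      (threeZeros (min p 5) (min q 5) (min r 5) (min t 5)) := by
  obtain ⟨a, ha⟩ := exists_digitShift_appendOnes_min p 0
  obtain ⟨b, hb⟩ := exists_digitShift_appendOnes_min q (2 * appendOnes (min p 5) 0)
  have hb' := (ha.two_mul.appendOnes q).trans hb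
  obtain ⟨c, hc⟩ := exists_digitShift_appendOnes_min r
    (2 * appendOnes (min q 5) (2 * appendOnes (min p 5) 0))
  have hc' := (hb'.two_mul.appendOnes r).trans hc
  obtain ⟨d, hd⟩ := exists_digitShift_appendOnes_min t
    (2 * appendOnes (min r 5) (2 * appendOnes (min q 5) (2 * appendOnes (min p 5) 0)))
  exact ⟨_, (hc'.two_mul.appendOnes t).trans hd⟩

theorem threeZeros_small_cases : ∀ p ∈ Finset.Icc 1 5, ∀ q ∈ Finset.Icc 0 5, ∀ r ∈ Finset.Icc 0 5,
    ∀ t ∈ Finset.Icc 1 5,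
    (∃ k ∈ [3, 5, 7, 9, 11, 15, 17, 25],
      bitSum (k * threeZeros p q r t) < bitSum (threeZeros p q r t)) ∨
    (p < 5 ∧ q < 5 ∧ r < 5 ∧ t < 5 ∧
      (∃ k ∈ [75, 83, 119, 145, 365, 395, 7085],
        bitSum (k * threeZeros p q r t) < bitSum (threeZeros p q r t))) ∨
    (p < 5 ∧ q < 5 ∧ r < 5 ∧ t < 5 ∧ threeZeros p q r t ∈ [17, 85, 89, 455]) ∨
    (p = 1 ∧ q = 0 ∧ t = 2) ∨ (p = 2 ∧ r = 0 ∧ t = 1) := by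
  decide +kernel

theorem stmt_13 (n : ℕ) (hn : 0 < n) (hodd : Odd n)
    (h0 : (Nat.digits 2 n).count 0 = 3) :
    (∀ k : ℕ, 1 ≤ k → (Nat.digits 2 n).sum ≤ (Nat.digits 2 (k * n)).sum) ↔
      (n = 17 ∨ n = 85 ∨ n = 89 ∨ n = 455 ∨
        (∃ i : ℕ, n = 2 ^ (i + 5) + 2 ^ (i + 3) - 5) ∨
        (∃ i : ℕ, n = 2 ^ (i + 5) + 2 ^ (i + 4) + 2 ^ (i + 3) - 7)) := by
  change (∀ k : ℕ, 1 ≤ k → bitSum n ≤ bitSum (k * n)) ↔ _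
  constructor
  · intro h
    obtain ⟨p, q, r, t, hp, ht, rfl⟩ := exists_eq_threeZeros hodd h0
    rcases threeZeros_small_cases (min p 5) (Finset.mem_Icc.2 (by omega))
        (min q 5) (Finset.mem_Icc.2 (by omega)) (min r 5) (Finset.mem_Icc.2 (by omega))
        (min t 5) (Finset.mem_Icc.2 (by omega)) with
      ⟨k, hk, hlt⟩ | ⟨h1, h2, h3, h4, k, hk, hlt⟩ | ⟨h1, h2, h3, h4, hmem⟩ | ⟨h1, h2, h3⟩ |
      ⟨h1, h2, h3⟩
    · obtain ⟨e, he⟩ := exists_digitShift_threeZeros_min p q r t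
      have hk' : 1 ≤ k ∧ k ≤ 32 := by
        simp only [List.mem_cons, List.not_mem_nil, or_false] at hk
        omega
      have e1 := he 1 0 (by norm_num) (by norm_num)
      have ek := he k 0 (by omega) hk'.2
      simp only [one_mul, add_zero] at e1 ek
      have := h k hk'.1
      omega
    · rw [min_eq_left (by omega), min_eq_left (by omega), min_eq_left (by omega),
        min_eq_left (by omega)] at hlt
      refine absurd (h k ?_) (not_le.2 hlt)
      rcases Nat.eq_zero_or_pos k with rfl | hk0
      · simp at hk
      · exact hk0
    · rw [min_eq_left (by omega), min_eq_left (by omega), min_eq_left (by omega),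
        min_eq_left (by omega)] at hmem
      simp only [List.mem_cons, List.not_mem_nil, or_false] at hmem
      tauto
    · obtain ⟨rfl, rfl, rfl⟩ : p = 1 ∧ q = 0 ∧ t = 2 := by omega
      refine .inr (.inr (.inr (.inr (.inl ⟨r, ?_⟩))))
      have : 0 < 2 ^ r := by positivity
      simp only [threeZeros, appendOnes, pow_add]
      omega
    · obtain ⟨rfl, rfl, rfl⟩ : p = 2 ∧ r = 0 ∧ t = 1 := by omega
      refine .inr (.inr (.inr (.inr (.inr ⟨q, ?_⟩))))
      have : 0 < 2 ^ q := by positivity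
      simp only [threeZeros, appendOnes, pow_add]
      omega
  · have sturdy_of_dvd {m : ℕ} (hm : 0 < m) (hdvd : n ∣ 2 ^ m - 1)
        (h : ∀ j ≤ 2 ^ m / n, 0 < j → bitSum n ≤ bitSum (n * j)) (k : ℕ) (hk : 1 ≤ k) :
        bitSum n ≤ bitSum (k * n) := by
      refine le_bitSum_of_dvd hm hdvd ?_ _ (Nat.mul_pos hk hn) (dvd_mul_left _ _)
      rintro _ hx hlt ⟨j, rfl⟩
      refine h j ?_ (Nat.pos_of_mul_pos_left hx)
      rw [Nat.le_div_iff_mul_le hn, mul_comm]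
      exact hlt.le
    have sturdy_of_mersenne_dvd {m : ℕ} (hm : 0 < m) (hdvd : 2 ^ m - 1 ∣ n) (hs : bitSum n = m)
        (k : ℕ) (hk : 1 ≤ k) : bitSum n ≤ bitSum (k * n) := by
      refine le_bitSum_of_dvd hm dvd_rfl (fun x hx hlt hdx => ?_) _ (Nat.mul_pos hk hn)
        (hdvd.mul_left k)
      have hx' : x = appendOnes m 0 := by
        have := Nat.le_of_dvd hx hdx
        simp only [appendOnes, mul_zero]
        omega
      rw [hx', bitSum_appendOnes, hs]
      exact Nat.le_add_right _ _
    rintro (rfl | rfl | rfl | rfl | ⟨i, rfl⟩ | ⟨i, rfl⟩)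
    · exact sturdy_of_dvd (m := 8) (by norm_num) (by norm_num) (by decide +kernel)
    · exact sturdy_of_dvd (m := 8) (by norm_num) (by norm_num) (by decide +kernel)
    · exact sturdy_of_dvd (m := 11) (by norm_num) (by norm_num) (by decide +kernel)
    · exact sturdy_of_dvd (m := 12) (by norm_num) (by norm_num) (by decide +kernel)
    · have hpow : 0 < 2 ^ i := by positivity
      refine sturdy_of_mersenne_dvd (m := i + 3) (by omega) ⟨5, ?_⟩ ?_
      · simp only [pow_add]
        omega
      · have : 2 ^ (i + 5) + 2 ^ (i + 3) - 5 = threeZeros 1 0 i 2 := by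
          simp only [threeZeros, appendOnes, pow_add]
          omega
        rw [this]
        simp only [threeZeros, bitSum_appendOnes, bitSum_two_mul]
        simp [bitSum]
        omega
    · have hpow : 0 < 2 ^ i := by positivity
      refine sturdy_of_mersenne_dvd (m := i + 3) (by omega) ⟨7, ?_⟩ ?_
      · simp only [pow_add]
        omega
      · have : 2 ^ (i + 5) + 2 ^ (i + 4) + 2 ^ (i + 3) - 7 = threeZeros 2 i 0 1 := by
          simp only [threeZeros, appendOnes, pow_add]
          omega
        rw [this]
        simp only [threeZeros, bitSum_appendOnes, bitSum_two_mul]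
        simp [bitSum]
        omega
end

section
/- Let F₃(N) denote the number of integers n with 2^{N−1} ≤ n < 2^N such that s_2(3n) < s_2(n) (the 3-flimsy numbers with N bits), and let c = 7√6/(24√π). Then F₃(N) = 2^N·(1/4 − c·N^{−1/2} + O(N^{−3/2})); that is, there exists a constant C > 0 such that for all integers N ≥ 1, |F₃(N) − 2^N·(1/4 − c·N^{−1/2})| ≤ C·2^N·N^{−3/2}. -/
open Finset Real

/-- The binary digit sum. -/
abbrev binarySum (n : ℕ) : ℕ := (Nat.digits 2 n).sum

theorem binarySum_two_mul (n : ℕ) : binarySum (2 * n) = binarySum n := by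
  rcases Nat.eq_zero_or_pos n with rfl | h
  · simp
  · simp [binarySum, Nat.digits_def' (b := 2) (n := 2 * n) (by norm_num) (by omega)]

theorem binarySum_two_mul_add_one (n : ℕ) : binarySum (2 * n + 1) = binarySum n + 1 := by
  rw [binarySum, Nat.digits_def' (by norm_num) (by omega), show (2 * n + 1) % 2 = 1 by omega,
    show (2 * n + 1) / 2 = n by omega, List.sum_cons, add_comm]

theorem sum_Ico_two_mul (f : ℕ → ℝ) {a b : ℕ} (hab : a ≤ b) :
    ∑ n ∈ Ico (2 * a) (2 * b), f n = ∑ n ∈ Ico a b, f (2 * n) + ∑ n ∈ Ico a b, f (2 * n + 1) := by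
  induction b, hab using Nat.le_induction with
  | base => simp
  | succ b hb ih =>
    rw [show 2 * (b + 1) = 2 * b + 1 + 1 by ring, sum_Ico_succ_top (by omega),
      sum_Ico_succ_top (by omega), ih, sum_Ico_succ_top hb, sum_Ico_succ_top hb]
    ring

/-- The number of `n` with `M + 1` bits for which the digit sum of `3 * n + c` is smaller than
that of `n`, increased by `w`. -/
noncomputable def carryCount (M c : ℕ) (w : ℤ) : ℝ :=
  ∑ n ∈ Ico (2 ^ M) (2 ^ (M + 1)),
    if (binarySum (3 * n + c) : ℤ) < binarySum n + w then 1 else 0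

theorem carryCount_succ (M c c₀ c₁ : ℕ) (w w₀ w₁ : ℤ)
    (h₀ : ∀ n, (binarySum (3 * (2 * n) + c) : ℤ) = binarySum (3 * n + c₀) + w - w₀)
    (h₁ : ∀ n, (binarySum (3 * (2 * n + 1) + c) : ℤ) = binarySum (3 * n + c₁) + w + 1 - w₁) :
    carryCount (M + 1) c w = carryCount M c₀ w₀ + carryCount M c₁ w₁ := by
  unfold carryCount
  rw [pow_succ' 2 (M + 1), pow_succ' 2 M, sum_Ico_two_mul _ (by omega), ← pow_succ' 2 M]
  congr 1 <;> refine sum_congr rfl fun n _ => if_congr ?_ rfl rfl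
  · rw [h₀, binarySum_two_mul]
    constructor <;> intro <;> linarith
  · rw [h₁, binarySum_two_mul_add_one]
    push_cast
    constructor <;> intro <;> linarith

theorem carryCount_zero_succ (M : ℕ) (w : ℤ) :
    carryCount (M + 1) 0 w = carryCount M 0 w + carryCount M 1 w := by
  refine carryCount_succ _ _ _ _ _ _ _ (fun n => ?_) fun n => ?_
  · rw [show 3 * (2 * n) + 0 = 2 * (3 * n + 0) by ring, binarySum_two_mul]; ring
  · rw [show 3 * (2 * n + 1) + 0 = 2 * (3 * n + 1) + 1 by ring, binarySum_two_mul_add_one]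
    push_cast; ring

theorem carryCount_one_succ (M : ℕ) (w : ℤ) :
    carryCount (M + 1) 1 w = carryCount M 0 (w - 1) + carryCount M 2 (w + 1) := by
  refine carryCount_succ _ _ _ _ _ _ _ (fun n => ?_) fun n => ?_
  · rw [show 3 * (2 * n) + 1 = 2 * (3 * n + 0) + 1 by ring, binarySum_two_mul_add_one]
    push_cast; ring
  · rw [show 3 * (2 * n + 1) + 1 = 2 * (3 * n + 2) by ring, binarySum_two_mul]
    ring

theorem carryCount_two_succ (M : ℕ) (w : ℤ) :
    carryCount (M + 1) 2 w = carryCount M 1 w + carryCount M 2 w := by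
  refine carryCount_succ _ _ _ _ _ _ _ (fun n => ?_) fun n => ?_
  · rw [show 3 * (2 * n) + 2 = 2 * (3 * n + 1) by ring, binarySum_two_mul]; ring
  · rw [show 3 * (2 * n + 1) + 2 = 2 * (3 * n + 2) + 1 by ring, binarySum_two_mul_add_one]
    push_cast; ring

theorem carryCount_zero_zero (w : ℤ) : carryCount 0 0 w = if 2 ≤ w then 1 else 0 := by
  simp only [carryCount, pow_zero, zero_add, pow_one, sum_singleton,
    show (Ico 1 2 : Finset ℕ) = {1} from rfl]
  refine if_congr ?_ rfl rfl
  norm_num [binarySum]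
  omega

theorem carryCount_zero_one (w : ℤ) : carryCount 0 1 w = if 1 ≤ w then 1 else 0 := by
  simp only [carryCount, pow_zero, zero_add, pow_one, sum_singleton,
    show (Ico 1 2 : Finset ℕ) = {1} from rfl]
  refine if_congr ?_ rfl rfl
  norm_num [binarySum]
  omega

theorem carryCount_zero_two (w : ℤ) : carryCount 0 2 w = if 2 ≤ w then 1 else 0 := by
  simp only [carryCount, pow_zero, zero_add, pow_one, sum_singleton,
    show (Ico 1 2 : Finset ℕ) = {1} from rfl]
  refine if_congr ?_ rfl rfl
  norm_num [binarySum]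
  omega

theorem carryCount_two_eq (M : ℕ) (w : ℤ) : carryCount M 2 w = carryCount M 0 w := by
  induction M with
  | zero => rw [carryCount_zero_zero, carryCount_zero_two]
  | succ M ih => rw [carryCount_two_succ, carryCount_zero_succ, ih, add_comm]

theorem carryCount_add_two (M : ℕ) (w : ℤ) :
    carryCount (M + 2) 0 w =
      carryCount (M + 1) 0 w + carryCount M 0 (w - 1) + carryCount M 0 (w + 1) := by
  rw [carryCount_zero_succ, carryCount_one_succ, carryCount_two_eq, add_assoc]

/-- A solution of the linear recurrence of the coefficients of `(1 - x - (z + z⁻¹) x²)⁻¹`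
determines the symmetrised counts. -/
theorem carryCount_symm {a : ℕ → ℤ → ℝ} (h0 : ∀ k, a 0 k = if k = 0 then 1 else 0)
    (h1 : ∀ k, a 1 k = a 0 k)
    (hrec : ∀ m k, a (m + 2) k = a (m + 1) k + a m (k - 1) + a m (k + 1)) (M : ℕ) (w : ℤ) :
    2 ^ (M + 1) - carryCount (M + 1) 0 w - carryCount (M + 1) 0 (-w) =
      a (M + 3) w - a (M + 2) w + a (M + 1) w + a M w := by
  have key : ∀ M, (∀ w, 2 ^ (M + 1) - carryCount (M + 1) 0 w - carryCount (M + 1) 0 (-w) =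
      a (M + 3) w - a (M + 2) w + a (M + 1) w + a M w) ∧
      ∀ w, 2 ^ (M + 2) - carryCount (M + 2) 0 w - carryCount (M + 2) 0 (-w) =
      a (M + 4) w - a (M + 3) w + a (M + 2) w + a (M + 1) w := by
    intro M
    induction M with
    | zero =>
      constructor <;> intro w
      · simp only [carryCount_zero_succ, carryCount_zero_zero, carryCount_zero_one, hrec, h1, h0,
          zero_add]
        grind
      · simp only [carryCount_add_two, carryCount_zero_succ, carryCount_zero_zero,
          carryCount_zero_one, hrec, h1, h0, zero_add]
        grind
    | succ M ih =>
      refine ⟨ih.2, fun w => ?_⟩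
      have e1 := ih.2 w
      have e2 := ih.1 (w - 1)
      have e3 := ih.1 (w + 1)
      have c1 := carryCount_add_two (M + 1) w
      have c2 := carryCount_add_two (M + 1) (-w)
      rw [show -(w - 1) = -w + 1 by ring] at e2
      rw [show -(w + 1) = -w - 1 by ring] at e3
      have r3 : a (M + 5) w = a (M + 4) w + a (M + 3) (w - 1) + a (M + 3) (w + 1) := hrec _ _
      have r2 : a (M + 4) w = a (M + 3) w + a (M + 2) (w - 1) + a (M + 2) (w + 1) := hrec _ _
      have r1 : a (M + 3) w = a (M + 2) w + a (M + 1) (w - 1) + a (M + 1) (w + 1) := hrec _ _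
      have r0 := hrec M w
      simp only [add_assoc, Nat.reduceAdd] at *
      rw [pow_add] at *
      linarith
  exact (key M).1 w

open PowerSeries in
/-- If `R² D = 1` with `D = (1 - x)² - 4 x⁴`, then the coefficients of `R qᵏ`, where `q` is the
small root of `x² (1 + q²) = (1 - x) q`, satisfy the recurrence of the coefficients of
`(1 - x - (z + z⁻¹) x²)⁻¹`. -/
theorem exists_recurrence_of_sq_mul_eq_one {R : ℝ⟦X⟧} (hR0 : constantCoeff R = 1)
    (hR : R ^ 2 * ((1 - X) ^ 2 - 4 * X ^ 4) = 1) :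
    ∃ a : ℕ → ℤ → ℝ, (∀ k, a 0 k = if k = 0 then 1 else 0) ∧ (∀ k, a 1 k = a 0 k) ∧
      (∀ m k, a (m + 2) k = a (m + 1) k + a m (k - 1) + a m (k + 1)) ∧
      ∀ m, a m 0 = coeff m R := by
  set D : ℝ⟦X⟧ := (1 - X) ^ 2 - 4 * X ^ 4 with hD
  set u : ℝ⟦X⟧ := 1 - X + D * R with hu
  have hu0 : constantCoeff u ≠ 0 := by
    simp [hu, hD, hR0]
  set v := u⁻¹ with hv
  have huv : u * v = 1 := PowerSeries.mul_inv_cancel u hu0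
  set q : ℝ⟦X⟧ := 2 * X ^ 2 * v with hq
  have hqq : X ^ 2 * (1 + q ^ 2) = q * (1 - X) := by
    have h1 : X ^ 2 * (u ^ 2 + 4 * X ^ 4) = 2 * X ^ 2 * (1 - X) * u := by
      rw [hu]
      linear_combination (X ^ 2 * D) * hR + X ^ 2 * hD
    rw [hq]
    linear_combination v ^ 2 * h1 - (X ^ 2 * (u * v + 1) - 2 * X ^ 2 * v * (1 - X)) * huv
  have hRq : R * (1 - X) = 1 + 2 * X ^ 2 * (R * q) := by
    have h1 : R * (1 - X) * u = u + 4 * X ^ 4 * R := by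
      rw [hu]
      linear_combination (1 - X) * hR - R * hD
    rw [hq]
    linear_combination v * h1 - (R * (1 - X) - 1) * huv
  have hq0 : constantCoeff q = 0 := by simp [hq]
  have hfun : ∀ k : ℤ, R * q ^ k.natAbs * (1 - X) = (if k = 0 then 1 else 0) +
      (R * q ^ (k - 1).natAbs + R * q ^ (k + 1).natAbs) * X ^ 2 := by
    intro k
    rcases lt_trichotomy k 0 with h | rfl | h
    · obtain ⟨n, rfl⟩ : ∃ n : ℕ, k = -(n + 1 : ℤ) := ⟨(-k - 1).toNat, by omega⟩
      rw [if_neg (by omega), show (-(n + 1 : ℤ)).natAbs = n + 1 by omega,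
        show (-(n + 1 : ℤ) - 1).natAbs = n + 2 by omega,
        show (-(n + 1 : ℤ) + 1).natAbs = n by omega]
      linear_combination -(R * q ^ n) * hqq
    · simp only [if_true, Int.natAbs_zero, zero_sub, zero_add, Int.natAbs_neg, Int.natAbs_one]
      linear_combination hRq
    · obtain ⟨n, rfl⟩ : ∃ n : ℕ, k = (n + 1 : ℤ) := ⟨(k - 1).toNat, by omega⟩
      rw [if_neg (by omega), show ((n + 1 : ℤ)).natAbs = n + 1 by omega,
        show ((n + 1 : ℤ) - 1).natAbs = n by omega,
        show ((n + 1 : ℤ) + 1).natAbs = n + 2 by omega]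
      linear_combination -(R * q ^ n) * hqq
  refine ⟨fun m k => coeff m (R * q ^ k.natAbs), fun k => ?_, fun k => ?_, fun m k => ?_, ?_⟩
  · by_cases hk : k = 0
    · simp [hk, hR0]
    · simp [hk, hR0, hq0]
  · have h := congrArg (coeff 1) (hfun k)
    rw [mul_sub, mul_one, map_sub, map_add, coeff_mul_X_pow',
      if_neg (show ¬ 2 ≤ 1 by norm_num), show 1 = 0 + 1 from rfl, coeff_succ_mul_X] at h
    have h2 : coeff (0 + 1) (if k = 0 then (1 : ℝ⟦X⟧) else 0) = 0 := by
      split_ifs <;> simp [coeff_one]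
    rw [h2] at h
    simp only [zero_add] at h
    linarith
  · have h := congrArg (coeff (m + 2)) (hfun k)
    rw [mul_sub, mul_one, map_sub, map_add, coeff_mul_X_pow,
      show m + 2 = (m + 1) + 1 from rfl, coeff_succ_mul_X] at h
    have h2 : coeff (m + 1 + 1) (if k = 0 then (1 : ℝ⟦X⟧) else 0) = 0 := by
      split_ifs <;> simp [coeff_one]
    rw [h2, map_add] at h
    simp only []
    linarith
  · simp

/-- The coefficients of `(1 + x² + 2 x³)^(-1/2)`. -/
noncomputable def invSqrtCubicCoeff : ℕ → ℝ
  | 0 => 1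
  | 1 => 0
  | 2 => -1 / 2
  | n + 3 => -((n + 2) * invSqrtCubicCoeff (n + 1) + (2 * n + 3) * invSqrtCubicCoeff n) / (n + 3)

theorem abs_invSqrtCubicCoeff_le : ∀ n, |invSqrtCubicCoeff n| ≤ (8 / 5) ^ n
  | 0 => by norm_num [invSqrtCubicCoeff]
  | 1 => by norm_num [invSqrtCubicCoeff]
  | 2 => by rw [invSqrtCubicCoeff, abs_of_neg (by norm_num)]; norm_num
  | n + 3 => by
    have h1 := abs_invSqrtCubicCoeff_le (n + 1)
    have h0 := abs_invSqrtCubicCoeff_le n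
    have hn : (0 : ℝ) ≤ n := n.cast_nonneg
    rw [invSqrtCubicCoeff, abs_div, abs_neg, abs_of_pos (show (0 : ℝ) < n + 3 by positivity),
      div_le_iff₀ (by positivity)]
    calc _ ≤ |(n + 2) * invSqrtCubicCoeff (n + 1)| + |(2 * n + 3) * invSqrtCubicCoeff n| :=
          abs_add_le _ _
      _ = (n + 2) * |invSqrtCubicCoeff (n + 1)| + (2 * n + 3) * |invSqrtCubicCoeff n| := by
          rw [abs_mul, abs_mul, abs_of_pos (show (0 : ℝ) < n + 2 by positivity),
            abs_of_pos (show (0 : ℝ) < 2 * n + 3 by positivity)]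
      _ ≤ (n + 2) * (8 / 5) ^ (n + 1) + (2 * n + 3) * (8 / 5) ^ n := by gcongr
      _ = (8 / 5) ^ n * ((n + 2) * (8 / 5) + (2 * n + 3)) := by ring
      _ ≤ (8 / 5) ^ n * ((8 / 5) ^ 3 * (n + 3)) := by gcongr; linarith
      _ = _ := by ring

open PowerSeries in
theorem sq_mul_eq_one_of_derivative {f p : ℝ⟦X⟧} (hf : constantCoeff f = 1)
    (hp : constantCoeff p = 1) (h : 2 * d⁄dX ℝ f * p + f * d⁄dX ℝ p = 0) : f ^ 2 * p = 1 := by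
  apply derivative.ext
  · rw [pow_two]
    simp only [Derivation.leibniz, smul_eq_mul, derivative_one]
    linear_combination f * h
  · simp [hf, hp]

open PowerSeries in
theorem mk_invSqrtCubicCoeff_sq_mul :
    (PowerSeries.mk invSqrtCubicCoeff) ^ 2 * (1 + X ^ 2 + 2 * X ^ 3 : ℝ⟦X⟧) = 1 := by
  apply sq_mul_eq_one_of_derivative
  · simp [← coeff_zero_eq_constantCoeff_apply, invSqrtCubicCoeff]
  · simp
  · have hd : d⁄dX ℝ (1 + X ^ 2 + 2 * X ^ 3 : ℝ⟦X⟧) = C 2 * X + C 6 * X ^ 2 := by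
      have h2 : (2 : ℝ⟦X⟧) = C 2 := (map_ofNat C 2).symm
      rw [show (C 6 : ℝ⟦X⟧) = 6 from map_ofNat C 6, h2]
      simp only [pow_succ, pow_zero, one_mul, map_add, Derivation.leibniz, smul_eq_mul,
        derivative_one, derivative_X, derivative_C]
      rw [← h2]
      ring
    rw [hd]
    have e : 2 * d⁄dX ℝ (PowerSeries.mk invSqrtCubicCoeff) * (1 + X ^ 2 + 2 * X ^ 3 : ℝ⟦X⟧) +
        PowerSeries.mk invSqrtCubicCoeff * (C 2 * X + C 6 * X ^ 2) =
        C 2 * d⁄dX ℝ (PowerSeries.mk invSqrtCubicCoeff) +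
        C 2 * (d⁄dX ℝ (PowerSeries.mk invSqrtCubicCoeff) * X ^ 2) +
        C 4 * (d⁄dX ℝ (PowerSeries.mk invSqrtCubicCoeff) * X ^ 3) +
        C 2 * (PowerSeries.mk invSqrtCubicCoeff * X ^ 1) + C 6 * (PowerSeries.mk invSqrtCubicCoeff * X ^ 2) := by
      rw [show (C 2 : ℝ⟦X⟧) = 2 from map_ofNat C 2, show (C 4 : ℝ⟦X⟧) = 4 from map_ofNat C 4]
      ring
    rw [e]
    ext n
    simp only [map_add, coeff_C_mul, coeff_mul_X_pow', coeff_derivative, coeff_mk, map_zero]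
    rcases n with _ | _ | n
    · norm_num [invSqrtCubicCoeff]
    · norm_num [invSqrtCubicCoeff]
    · rw [if_pos (show 2 ≤ n + 1 + 1 by omega), if_pos (show 1 ≤ n + 1 + 1 by omega)]
      rcases n with _ | n
      · norm_num [invSqrtCubicCoeff]
      · rw [if_pos (show 3 ≤ n + 1 + 1 + 1 by omega)]
        simp only [show n + 1 + 1 + 1 = n + 3 by ring, show n + 3 + 1 = (n + 1) + 3 by ring,
          show n + 3 - 2 = n + 1 by omega, show n + 3 - 3 = n by omega,
          show n + 3 - 1 = n + 2 by omega, show n + 1 + 1 = n + 2 by ring]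
        rw [invSqrtCubicCoeff]
        push_cast
        field_simp
        ring

open PowerSeries in
theorem mk_centralBinom_div_sq_mul :
    (PowerSeries.mk fun n => (n.centralBinom : ℝ) / 2 ^ n) ^ 2 * (1 - 2 * X : ℝ⟦X⟧) = 1 := by
  apply sq_mul_eq_one_of_derivative
  · simp [← coeff_zero_eq_constantCoeff_apply]
  · simp
  · set f : ℝ⟦X⟧ := PowerSeries.mk fun n => (n.centralBinom : ℝ) / 2 ^ n with hf
    have hd : d⁄dX ℝ (1 - 2 * X : ℝ⟦X⟧) = - C 2 := by
      have h2 : (2 : ℝ⟦X⟧) = C 2 := (map_ofNat C 2).symm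
      rw [h2]
      simp [Derivation.leibniz, smul_eq_mul]
    have e : 2 * d⁄dX ℝ f * (1 - 2 * X) + f * (- C 2) =
        C 2 * d⁄dX ℝ f - C 4 * (d⁄dX ℝ f * X ^ 1) - C 2 * f := by
      rw [show (C 2 : ℝ⟦X⟧) = 2 from map_ofNat C 2, show (C 4 : ℝ⟦X⟧) = 4 from map_ofNat C 4]
      ring
    rw [hd, e]
    ext n
    simp only [map_sub, coeff_C_mul, coeff_mul_X_pow', coeff_derivative, coeff_mk, map_zero, hf]
    rcases n with _ | n
    · simp [Nat.centralBinom]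
    · have h := Nat.succ_mul_centralBinom_succ (n + 1)
      rify at h
      rw [if_pos (by omega), Nat.add_sub_cancel]
      push_cast
      rw [pow_succ 2 (n + 1)]
      field_simp
      linear_combination h

/-- The probability that a simple random walk of length `2 * n` ends where it started. -/
noncomputable def returnProb (n : ℕ) : ℝ := n.centralBinom / 4 ^ n

theorem returnProb_pos (n : ℕ) : 0 < returnProb n :=
  div_pos (by exact_mod_cast n.centralBinom_pos) (by positivity)

theorem returnProb_succ (n : ℕ) :
    returnProb (n + 1) = returnProb n * ((2 * n + 1) / (2 * n + 2)) := by
  have h := Nat.succ_mul_centralBinom_succ n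
  rify at h
  unfold returnProb
  rw [pow_succ]
  field_simp
  linear_combination 2 * h

theorem returnProb_sq_mul_wallis (n : ℕ) :
    returnProb n ^ 2 * (2 * n + 1) * Wallis.W n = 1 := by
  have h : (n.centralBinom : ℝ) * n.factorial ^ 2 = (2 * n).factorial := by
    have := Nat.choose_mul_factorial_mul_factorial (show n ≤ 2 * n by omega)
    rw [show 2 * n - n = n by omega] at this
    rw [Nat.centralBinom_eq_two_mul_choose, ← this]
    push_cast
    ring
  have h1 : (n.factorial : ℝ) ≠ 0 := by exact_mod_cast n.factorial_ne_zero
  have h2 : (n.centralBinom : ℝ) ≠ 0 := by exact_mod_cast n.centralBinom_ne_zero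
  rw [Wallis.W_eq_factorial_ratio, returnProb, ← h, pow_mul]
  field_simp
  rw [← pow_mul, ← pow_mul, mul_comm n 2, pow_mul, pow_mul]
  norm_num

theorem le_returnProb_sq (n : ℕ) : 2 / (π * (2 * n + 1)) ≤ returnProb n ^ 2 := by
  have h := returnProb_sq_mul_wallis n
  have hW := Wallis.W_le n
  have hπ := Real.pi_pos
  rw [div_le_iff₀ (by positivity)]
  have : returnProb n ^ 2 * (2 * n + 1) * Wallis.W n ≤
      returnProb n ^ 2 * (2 * n + 1) * (π / 2) := by gcongr
  linarith

theorem returnProb_sq_le (n : ℕ) :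
    returnProb n ^ 2 ≤ 4 * (n + 1) / (π * (2 * n + 1) ^ 2) := by
  have h := returnProb_sq_mul_wallis n
  have hW := Wallis.le_W n
  have hπ := Real.pi_pos
  have : returnProb n ^ 2 * (2 * n + 1) * (((2 : ℝ) * n + 1) / (2 * n + 2) * (π / 2)) ≤
      returnProb n ^ 2 * (2 * n + 1) * Wallis.W n := by gcongr
  rw [h] at this
  rw [le_div_iff₀ (by positivity)]
  have e : returnProb n ^ 2 * (2 * n + 1) * (((2 : ℝ) * n + 1) / (2 * n + 2) * (π / 2)) =
    returnProb n ^ 2 * (π * (2 * n + 1) ^ 2) / (4 * (n + 1)) := by field_simp; ring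
  rw [e, div_le_one (by positivity)] at this
  exact this

theorem inv_sqrt_sq {x : ℝ} (hx : 0 ≤ x) : (√x)⁻¹ ^ 2 = x⁻¹ := by
  rw [inv_pow, Real.sq_sqrt hx]

theorem returnProb_le (n : ℕ) : returnProb n ≤ (√(n + 1))⁻¹ := by
  have key : returnProb n ^ 2 * (n + 1) ≤ 1 := by
    induction n with
    | zero => simp [returnProb]
    | succ n ih =>
      refine le_trans ?_ ih
      rw [returnProb_succ, mul_pow, mul_assoc]
      gcongr
      rw [div_pow, div_mul_eq_mul_div, div_le_iff₀ (by positivity)]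
      push_cast
      have : (0 : ℝ) ≤ n := n.cast_nonneg
      nlinarith
  apply le_of_sq_le_sq _ (by positivity)
  rw [inv_sqrt_sq (by positivity), ← one_div, le_div_iff₀ (by positivity)]
  exact key

theorem half_inv_sqrt_le_returnProb (n : ℕ) : (√(n + 1))⁻¹ / 2 ≤ returnProb n := by
  apply le_of_sq_le_sq _ (returnProb_pos n).le
  refine le_trans ?_ (le_returnProb_sq n)
  have hπ := Real.pi_pos
  have hπ4 := Real.pi_le_four
  rw [div_pow, inv_sqrt_sq (by positivity), ← one_div, div_div,
    div_le_div_iff₀ (by positivity) (by positivity)]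
  have : (0 : ℝ) ≤ n := n.cast_nonneg
  nlinarith

theorem returnProb_add_le (n k : ℕ) : returnProb (n + k) ≤ returnProb n := by
  induction k with
  | zero => rfl
  | succ k ih =>
    refine le_trans ?_ ih
    rw [← add_assoc, returnProb_succ]
    refine mul_le_of_le_one_right (returnProb_pos _).le ?_
    rw [div_le_one (by positivity)]
    linarith

theorem returnProb_sub_le (n k : ℕ) :
    returnProb n - returnProb (n + k) ≤ k * (√(n + 1))⁻¹ ^ 3 := by
  induction k with
  | zero => simp
  | succ k ih =>
    have h : returnProb (n + k) - returnProb (n + k + 1) ≤ (√(n + 1))⁻¹ ^ 3 := by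
      have e : returnProb (n + k) - returnProb (n + k + 1) =
          returnProb (n + k) * (2 * (n + k) + 2 : ℝ)⁻¹ := by
        rw [returnProb_succ]; push_cast; field_simp; ring
      rw [e, pow_succ', inv_sqrt_sq (by positivity)]
      gcongr
      · exact (returnProb_add_le n k).trans (returnProb_le n)
      · have : (0 : ℝ) ≤ n := n.cast_nonneg
        have : (0 : ℝ) ≤ k := k.cast_nonneg
        linarith
      · norm_num
    rw [← add_assoc]
    push_cast
    linarith

theorem abs_shifted_returnProb_sub_le (m k : ℕ) :
    |(if k ≤ m then returnProb (m - k) else 0) - returnProb m| ≤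
      (k + 1) ^ 4 * (√(m + 1))⁻¹ ^ 3 := by
  have hk0 : (0 : ℝ) ≤ k := k.cast_nonneg
  split_ifs with h
  · obtain ⟨n, rfl⟩ := Nat.exists_eq_add_of_le' h
    rw [Nat.add_sub_cancel, abs_of_nonneg (sub_nonneg.2 (returnProb_add_le n k))]
    refine (returnProb_sub_le n k).trans ?_
    have hs : (√(n + 1))⁻¹ ≤ (k + 1) * (√((n + k : ℕ) + 1))⁻¹ := by
      have hn0 : (0 : ℝ) ≤ n := n.cast_nonneg
      apply le_of_sq_le_sq _ (by positivity)
      rw [mul_pow, inv_sqrt_sq (by positivity), inv_sqrt_sq (by positivity), ← div_eq_mul_inv,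
        ← one_div, div_le_div_iff₀ (by positivity) (by positivity)]
      push_cast
      nlinarith [mul_nonneg hn0 hk0, mul_nonneg (mul_nonneg hn0 hk0) hk0]
    calc _ ≤ (k + 1 : ℝ) * ((k + 1) * (√((n + k : ℕ) + 1))⁻¹) ^ 3 := by gcongr; linarith
      _ = _ := by ring
  · rw [zero_sub, abs_neg, abs_of_pos (returnProb_pos m)]
    refine (returnProb_le m).trans ?_
    have hm : (m + 1 : ℝ) ≤ k + 1 := by exact_mod_cast (by omega : m + 1 ≤ k + 1)
    have h1 : (1 : ℝ) ≤ k + 1 := by linarith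
    calc (√(m + 1))⁻¹ = (m + 1) * (√(m + 1))⁻¹ ^ 3 := by
          rw [pow_succ, inv_sqrt_sq (by positivity)]; field_simp
      _ ≤ (k + 1) ^ 4 * (√(m + 1))⁻¹ ^ 3 := by
          gcongr
          exact hm.trans (le_self_pow₀ h1 (by norm_num))

theorem exists_abs_convolution_sub_le {η : ℕ → ℝ} (hη : ∀ k, |η k| ≤ (4 / 5) ^ k) :
    ∃ C : ℝ, 0 ≤ C ∧ ∀ m : ℕ,
      |∑ k ∈ range (m + 1), η k * returnProb (m - k) - (∑' k, η k) * returnProb m| ≤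
        C * (√(m + 1))⁻¹ ^ 3 := by
  have hsη : Summable η := by
    refine Summable.of_norm_bounded (summable_geometric_of_lt_one (r := (4 / 5 : ℝ))
      (by norm_num) (by norm_num)) hη
  have hs : Summable fun k : ℕ => (4 / 5 : ℝ) ^ k * (k + 1) ^ 4 := by
    have h := (summable_nat_add_iff 1).2
      (summable_pow_mul_geometric_of_norm_lt_one 4 (r := (4 / 5 : ℝ)) (by norm_num))
    refine (h.mul_left (5 / 4)).congr fun k => ?_
    push_cast
    ring
  refine ⟨∑' k : ℕ, (4 / 5 : ℝ) ^ k * (k + 1) ^ 4, tsum_nonneg fun k => by positivity,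
    fun m => ?_⟩
  set g : ℕ → ℝ := fun k => if k ≤ m then returnProb (m - k) else 0 with hg
  have h1 : ∑ k ∈ range (m + 1), η k * returnProb (m - k) = ∑' k, η k * g k := by
    rw [tsum_eq_sum (s := range (m + 1))]
    · refine sum_congr rfl fun k hk => ?_
      rw [hg]; simp only []
      rw [if_pos (by simpa [Nat.lt_succ_iff] using hk)]
    · intro k hk
      rw [hg]; simp only []
      rw [if_neg (by simpa [Nat.lt_succ_iff] using hk), mul_zero]
  have hsg : Summable fun k => η k * g k :=
    summable_of_ne_finset_zero (s := range (m + 1)) fun k hk => by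
      rw [hg]; simp only []
      rw [if_neg (by simpa [Nat.lt_succ_iff] using hk), mul_zero]
  rw [h1, ← tsum_mul_right, ← hsg.tsum_sub (hsη.mul_right _), ← Real.norm_eq_abs, ← tsum_mul_right]
  refine tsum_of_norm_bounded (hs.mul_right _).hasSum fun k => ?_
  rw [← mul_sub, norm_mul, mul_assoc]
  exact mul_le_mul (hη k) (abs_shifted_returnProb_sub_le m k) (norm_nonneg _) (by positivity)

theorem abs_returnProb_sub_inv_sqrt_le {m N : ℕ} (hN : 1 ≤ N) (h1 : m ≤ N + 1) (h2 : N ≤ m + 2) :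
    |returnProb m - (√(π * N))⁻¹| ≤ 42 * (√N)⁻¹ ^ 3 := by
  have hπ := Real.pi_pos
  have hN' : (1 : ℝ) ≤ N := by exact_mod_cast hN
  have h1' : (m : ℝ) ≤ N + 1 := by exact_mod_cast h1
  have h2' : (N : ℝ) ≤ m + 2 := by exact_mod_cast h2
  have hm : (0 : ℝ) ≤ m := m.cast_nonneg
  set y := (√(π * N))⁻¹ with hy
  have hy0 : 0 < y := by positivity
  have hy2 : y ^ 2 = 1 / (π * N) := by rw [hy, inv_sqrt_sq (by positivity), one_div]
  have hsq : |returnProb m ^ 2 - y ^ 2| ≤ 21 / (π * N ^ 2) := by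
    rw [abs_le, hy2]
    constructor
    · have : 1 / (π * N) - 21 / (π * N ^ 2) ≤ 2 / (π * (2 * m + 1)) := by
        have e : 1 / (π * N) - 21 / (π * N ^ 2) = (N - 21) / (π * N ^ 2) := by field_simp
        rw [e, div_le_div_iff₀ (by positivity) (by positivity)]
        have : ((N : ℝ) - 21) * (2 * m + 1) ≤ 2 * N ^ 2 := by nlinarith
        nlinarith
      linarith [le_returnProb_sq m]
    · have : 4 * (m + 1) / (π * (2 * m + 1) ^ 2) ≤ 1 / (π * N) + 21 / (π * N ^ 2) := by
        have e : 1 / (π * N) + 21 / (π * N ^ 2) = (N + 21) / (π * N ^ 2) := by field_simp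
        rw [e, div_le_div_iff₀ (by positivity) (by positivity)]
        have : 4 * (m + 1) * (N : ℝ) ^ 2 ≤ (N + 21) * (2 * m + 1) ^ 2 := by
          have a1 : 4 * (m + 1) * (N : ℝ) ≤ (2 * m + 1) ^ 2 + 7 * (2 * m + 1) := by nlinarith
          have a2 : (N : ℝ) ≤ 3 * (2 * m + 1) := by linarith
          nlinarith [mul_le_mul_of_nonneg_right a1 (show (0 : ℝ) ≤ N by linarith),
            mul_le_mul_of_nonneg_right a2 (show (0 : ℝ) ≤ 7 * (2 * m + 1) by linarith)]
        nlinarith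
      linarith [returnProb_sq_le m]
  have hfac : |returnProb m - y| * y ≤ 21 / (π * N ^ 2) := by
    refine le_trans ?_ hsq
    rw [show returnProb m ^ 2 - y ^ 2 = (returnProb m - y) * (returnProb m + y) by ring, abs_mul]
    gcongr
    rw [abs_of_pos (add_pos (returnProb_pos m) hy0)]
    linarith [returnProb_pos m]
  have hy1 : y * (√π * √N) = 1 := by
    rw [hy, Real.sqrt_mul hπ.le, inv_mul_cancel₀ (by positivity)]
  have hsN : (√N : ℝ) ^ 2 = N := Real.sq_sqrt (by positivity)
  have hsπ : √π ^ 2 = π := Real.sq_sqrt hπ.le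
  have hsπ1 : 1 ≤ √π := Real.one_le_sqrt.2 (by linarith [Real.pi_gt_three])
  calc |returnProb m - y| = |returnProb m - y| * y * (√π * √N) := by rw [mul_assoc, hy1, mul_one]
    _ ≤ 21 / (π * N ^ 2) * (√π * √N) := by gcongr
    _ = 21 / √π * (√N)⁻¹ ^ 3 := by
        nth_rewrite 1 [← hsπ]
        nth_rewrite 1 [← hsN]
        field_simp
    _ ≤ 42 * (√N)⁻¹ ^ 3 := by
        gcongr
        rw [div_le_iff₀ (by positivity)]
        linarith

open PowerSeries in
theorem tsum_coeff_mul {f g : ℝ⟦X⟧} {x : ℝ} (hf : Summable fun n => ‖coeff n f * x ^ n‖)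
    (hg : Summable fun n => ‖coeff n g * x ^ n‖) :
    (Summable fun n => ‖coeff n (f * g) * x ^ n‖) ∧
      ∑' n, coeff n (f * g) * x ^ n = (∑' n, coeff n f * x ^ n) * ∑' n, coeff n g * x ^ n := by
  have e : ∀ n, coeff n (f * g) * x ^ n =
      ∑ ij ∈ antidiagonal n, (coeff ij.1 f * x ^ ij.1) * (coeff ij.2 g * x ^ ij.2) := by
    intro n
    rw [coeff_mul, sum_mul]
    refine sum_congr rfl fun ij hij => ?_
    rw [← mem_antidiagonal.1 hij, pow_add]
    ring
  simp only [e]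
  have h1 := summable_norm_sum_mul_antidiagonal_of_summable_norm (R := ℝ)
    (f := fun n => coeff n f * x ^ n) (g := fun n => coeff n g * x ^ n) hf hg
  have h2 := tsum_mul_tsum_eq_tsum_sum_antidiagonal_of_summable_norm (R := ℝ)
    (f := fun n => coeff n f * x ^ n) (g := fun n => coeff n g * x ^ n) hf hg
  exact ⟨h1, h2.symm⟩

theorem abs_invSqrtCubicCoeff_mul_le (k : ℕ) :
    |invSqrtCubicCoeff k * (1 / 2) ^ k| ≤ (4 / 5) ^ k := by
  rw [abs_mul, abs_of_pos (show (0 : ℝ) < (1 / 2) ^ k by positivity)]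
  calc _ ≤ (8 / 5 : ℝ) ^ k * (1 / 2) ^ k := by gcongr; exact abs_invSqrtCubicCoeff_le k
    _ = (4 / 5) ^ k := by rw [← mul_pow]; norm_num

open PowerSeries in
theorem tsum_invSqrtCubicCoeff_sq : (∑' k, invSqrtCubicCoeff k * (1 / 2) ^ k) ^ 2 = 2 / 3 := by
  set H : ℝ⟦X⟧ := PowerSeries.mk invSqrtCubicCoeff with hH
  set P : ℝ⟦X⟧ := 1 + X ^ 2 + 2 * X ^ 3 with hP
  have hs : Summable fun n => ‖coeff n H * (1 / 2) ^ n‖ := by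
    refine Summable.of_nonneg_of_le (fun _ => norm_nonneg _) (fun k => ?_)
      (summable_geometric_of_lt_one (r := (4 / 5 : ℝ)) (by norm_num) (by norm_num))
    rw [hH, coeff_mk]
    exact abs_invSqrtCubicCoeff_mul_le k
  have hPc : ∀ n, coeff n P =
      (if n = 0 then 1 else 0) + (if n = 2 then 1 else 0) + 2 * (if n = 3 then 1 else 0) := by
    intro n
    rw [hP, show (2 : ℝ⟦X⟧) = C 2 from (map_ofNat C 2).symm, map_add, map_add, coeff_C_mul,
      coeff_one, coeff_X_pow, coeff_X_pow]
  have hP0 : ∀ n ∉ range 4, coeff n P * (1 / 2) ^ n = 0 := by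
    intro n hn
    rw [mem_range] at hn
    rw [hPc, if_neg (by omega), if_neg (by omega), if_neg (by omega)]
    ring
  have hsP : Summable fun n => ‖coeff n P * (1 / 2) ^ n‖ :=
    summable_of_ne_finset_zero (s := range 4) fun n hn => by rw [hP0 n hn, norm_zero]
  have hPv : ∑' n, coeff n P * (1 / 2) ^ n = 3 / 2 := by
    rw [tsum_eq_sum hP0]
    simp only [hPc, sum_range_succ]
    norm_num
  obtain ⟨hs2, h2⟩ := tsum_coeff_mul hs hs
  obtain ⟨-, h3⟩ := tsum_coeff_mul hs2 hsP
  have h1 : H * H * P = 1 := by rw [← pow_two]; exact mk_invSqrtCubicCoeff_sq_mul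
  have hone : ∑' n, coeff n (1 : ℝ⟦X⟧) * (1 / 2 : ℝ) ^ n = 1 := by
    rw [tsum_eq_single 0 fun n hn => by rw [coeff_one, if_neg hn, zero_mul]]
    simp
  rw [h1, hone, h2, hPv] at h3
  simp only [hH, coeff_mk] at h3
  linarith

/-- The power series `((1 - x)² - 4 x⁴)^(-1/2)`. -/
noncomputable def invSqrtQuartic : PowerSeries ℝ :=
  PowerSeries.mk invSqrtCubicCoeff * PowerSeries.mk fun n => (n.centralBinom : ℝ) / 2 ^ n

open PowerSeries in
theorem constantCoeff_invSqrtQuartic : constantCoeff invSqrtQuartic = 1 := by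
  rw [invSqrtQuartic, map_mul, ← coeff_zero_eq_constantCoeff_apply,
    ← coeff_zero_eq_constantCoeff_apply, coeff_mk, coeff_mk]
  simp [invSqrtCubicCoeff]

open PowerSeries in
theorem invSqrtQuartic_sq_mul : invSqrtQuartic ^ 2 * ((1 - X) ^ 2 - 4 * X ^ 4) = 1 := by
  have h1 := mk_invSqrtCubicCoeff_sq_mul
  have h2 := mk_centralBinom_div_sq_mul
  rw [invSqrtQuartic, mul_pow, show ((1 - X) ^ 2 - 4 * X ^ 4 : ℝ⟦X⟧) =
    (1 + X ^ 2 + 2 * X ^ 3) * (1 - 2 * X) by ring, mul_mul_mul_comm, h1, h2, one_mul]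

open PowerSeries in
theorem coeff_invSqrtQuartic_div (m : ℕ) : coeff m invSqrtQuartic / 2 ^ m =
    ∑ k ∈ range (m + 1), invSqrtCubicCoeff k * (1 / 2) ^ k * returnProb (m - k) := by
  rw [invSqrtQuartic, coeff_mul, Nat.sum_antidiagonal_eq_sum_range_succ_mk, sum_div]
  refine sum_congr rfl fun k hk => ?_
  obtain ⟨n, rfl⟩ := Nat.exists_eq_add_of_le (Nat.lt_succ_iff.1 (mem_range.1 hk))
  rw [Nat.add_sub_cancel_left, coeff_mk, coeff_mk, returnProb, one_div, inv_pow, pow_add,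
    show (4 : ℝ) = 2 * 2 by norm_num, mul_pow]
  field_simp

theorem tsum_invSqrtCubicCoeff (h : ∀ m, 0 ≤ PowerSeries.coeff m invSqrtQuartic) :
    ∑' k, invSqrtCubicCoeff k * (1 / 2) ^ k = √6 / 3 := by
  set L := ∑' k, invSqrtCubicCoeff k * (1 / 2) ^ k with hL
  have hsq : L ^ 2 = 2 / 3 := tsum_invSqrtCubicCoeff_sq
  have hL0 : 0 ≤ L := by
    obtain ⟨C, hC, hb⟩ := exists_abs_convolution_sub_le abs_invSqrtCubicCoeff_mul_le
    by_contra! hneg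
    obtain ⟨m, hm⟩ := exists_nat_gt (2 * C / -L)
    rw [div_lt_iff₀ (by linarith)] at hm
    have h1 := (abs_le.1 (hb m)).2
    rw [← coeff_invSqrtQuartic_div, ← hL] at h1
    have h2 : 0 ≤ PowerSeries.coeff m invSqrtQuartic / 2 ^ m := div_nonneg (h m) (by positivity)
    have h3 := mul_le_mul_of_nonpos_left (half_inv_sqrt_le_returnProb m) hneg.le
    have hp : 0 < (√((m : ℝ) + 1))⁻¹ := by positivity
    have h4 : 0 ≤ (√((m : ℝ) + 1))⁻¹ * (L / 2 + C * (√((m : ℝ) + 1))⁻¹ ^ 2) := by linarith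
    have h5 := nonneg_of_mul_nonneg_right h4 hp
    have h6 : C * ((m : ℝ) + 1)⁻¹ * (m + 1) = C := by field_simp
    rw [inv_sqrt_sq (by positivity)] at h5
    have h7 := mul_nonneg h5 (show (0 : ℝ) ≤ m + 1 by positivity)
    linarith
  rw [eq_div_iff (by norm_num)]
  rw [← Real.sqrt_sq (show 0 ≤ L * 3 by positivity), mul_pow, hsq]
  norm_num

theorem exists_abs_coeff_invSqrtQuartic_sub_le
    (h : ∀ m, 0 ≤ PowerSeries.coeff m invSqrtQuartic) :
    ∃ C : ℝ, 0 < C ∧ ∀ N m : ℕ, 2 ≤ N → m ≤ N + 1 → N ≤ m + 2 →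
      |PowerSeries.coeff m invSqrtQuartic / 2 ^ m - √6 / 3 * (√(π * N))⁻¹| ≤
        C * (√N)⁻¹ ^ 3 := by
  obtain ⟨C, hC, hb⟩ := exists_abs_convolution_sub_le abs_invSqrtCubicCoeff_mul_le
  refine ⟨C * 8 + √6 / 3 * 42, by positivity, fun N m hN h1 h2 => ?_⟩
  have hb' := hb m
  rw [← coeff_invSqrtQuartic_div, tsum_invSqrtCubicCoeff h] at hb'
  have hr := abs_returnProb_sub_inv_sqrt_le (by omega) h1 h2
  have hs : (√((m : ℝ) + 1))⁻¹ ≤ 2 * (√N)⁻¹ := by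
    have : (N : ℝ) ≤ 2 * (m + 1) := by exact_mod_cast (by omega : N ≤ 2 * (m + 1))
    have hN' : (0 : ℝ) < N := by exact_mod_cast (by omega : 0 < N)
    apply le_of_sq_le_sq _ (by positivity)
    rw [mul_pow, inv_sqrt_sq (by positivity), inv_sqrt_sq (by positivity), ← div_eq_mul_inv,
      ← one_div, div_le_div_iff₀ (by positivity) (by positivity)]
    linarith
  calc _ = |(PowerSeries.coeff m invSqrtQuartic / 2 ^ m - √6 / 3 * returnProb m) +
        √6 / 3 * (returnProb m - (√(π * N))⁻¹)| := by ring_nf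
    _ ≤ C * (√((m : ℝ) + 1))⁻¹ ^ 3 + √6 / 3 * (42 * (√N)⁻¹ ^ 3) := by
        refine (abs_add_le _ _).trans (add_le_add hb' ?_)
        rw [abs_mul, abs_of_pos (show 0 < √6 / 3 by positivity)]
        gcongr
    _ ≤ C * (2 * (√N)⁻¹) ^ 3 + √6 / 3 * (42 * (√N)⁻¹ ^ 3) := by gcongr
    _ = _ := by ring

theorem card_flimsy_eq_carryCount (M : ℕ) :
    (((Finset.Ico (2 ^ M) (2 ^ (M + 1))).filter
      (fun n => (Nat.digits 2 (3 * n)).sum < (Nat.digits 2 n).sum)).card : ℝ) =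
      carryCount M 0 0 := by
  rw [card_filter, carryCount, Nat.cast_sum]
  refine sum_congr rfl fun n _ => ?_
  rw [Nat.cast_ite, Nat.cast_one, Nat.cast_zero]
  refine if_congr ?_ rfl rfl
  rw [add_zero, add_zero, Nat.cast_lt]

theorem exists_carryCount_eq :
    (∀ m, 0 ≤ PowerSeries.coeff m invSqrtQuartic) ∧
      ∀ M, carryCount (M + 1) 0 0 = 2 ^ M -
        (PowerSeries.coeff (M + 3) invSqrtQuartic - PowerSeries.coeff (M + 2) invSqrtQuartic +
          PowerSeries.coeff (M + 1) invSqrtQuartic + PowerSeries.coeff M invSqrtQuartic) / 2 := by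
  obtain ⟨a, h0, h1, hrec, ha⟩ :=
    exists_recurrence_of_sq_mul_eq_one constantCoeff_invSqrtQuartic invSqrtQuartic_sq_mul
  constructor
  · have h : ∀ m, (∀ k, 0 ≤ a m k) ∧ ∀ k, 0 ≤ a (m + 1) k := by
      intro m
      induction m with
      | zero =>
        have : ∀ k, 0 ≤ a 0 k := fun k => by rw [h0]; split_ifs <;> norm_num
        exact ⟨this, fun k => by rw [zero_add, h1]; exact this k⟩
      | succ m ih =>
        refine ⟨ih.2, fun k => ?_⟩
        rw [hrec]
        linarith [ih.2 k, ih.1 (k - 1), ih.1 (k + 1)]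
    intro m
    rw [← ha]
    exact (h m).1 0
  · intro M
    have h := carryCount_symm h0 h1 hrec M 0
    rw [neg_zero, ha, ha, ha, ha, pow_succ] at h
    linarith

theorem inv_sqrt_cast_eq_rpow (N : ℕ) : (√(N : ℝ))⁻¹ = (N : ℝ) ^ (-(1 / 2 : ℝ)) := by
  rw [Real.rpow_neg N.cast_nonneg, Real.sqrt_eq_rpow]

theorem inv_sqrt_cast_cube_eq_rpow (N : ℕ) :
    (√(N : ℝ))⁻¹ ^ 3 = (N : ℝ) ^ (-(3 / 2 : ℝ)) := by
  rw [inv_sqrt_cast_eq_rpow, ← Real.rpow_mul_natCast N.cast_nonneg]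
  norm_num

theorem stmt_14 :
    ∃ C : ℝ, 0 < C ∧ ∀ N : ℕ, 1 ≤ N →
      |(((Finset.Ico (2 ^ (N - 1)) (2 ^ N)).filter
            (fun n => (Nat.digits 2 (3 * n)).sum < (Nat.digits 2 n).sum)).card : ℝ) -
          2 ^ N * (1 / 4 - (7 * Real.sqrt 6 / (24 * Real.sqrt π)) *
            (N : ℝ) ^ (-(1 / 2 : ℝ)))| ≤
        C * 2 ^ N * (N : ℝ) ^ (-(3 / 2 : ℝ)) := by
  obtain ⟨hpos, hcount⟩ := exists_carryCount_eq
  obtain ⟨C, hC, hb⟩ := exists_abs_coeff_invSqrtQuartic_sub_le hpos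
  set c := 7 * √6 / (24 * √π) with hc
  refine ⟨2 * C + |1 / 4 - c|, by positivity, fun N hN => ?_⟩
  rw [← inv_sqrt_cast_eq_rpow, ← inv_sqrt_cast_cube_eq_rpow]
  obtain ⟨M, rfl⟩ := Nat.exists_eq_add_of_le' hN
  rw [Nat.add_sub_cancel, card_flimsy_eq_carryCount]
  rcases M with _ | M
  · rw [carryCount_zero_zero, if_neg (by norm_num), zero_sub, abs_neg, abs_mul]
    norm_num
    linarith
  · have b3 := hb (M + 2) (M + 3) (by omega) (by omega) (by omega)
    have b2 := hb (M + 2) (M + 2) (by omega) (by omega) (by omega)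
    have b1 := hb (M + 2) (M + 1) (by omega) (by omega) (by omega)
    have b0 := hb (M + 2) M (by omega) (by omega) (by omega)
    rw [hcount, show M + 1 + 1 = M + 2 by rfl]
    set r := (√((M + 2 : ℕ) : ℝ))⁻¹ with hr
    have hr0 : 0 ≤ r := by positivity
    have hy : √6 / 3 * (√(π * (M + 2 : ℕ)))⁻¹ = 8 / 7 * c * r := by
      rw [Real.sqrt_mul Real.pi_pos.le, hc, hr]
      field_simp
      norm_num
    rw [hy] at b0 b1 b2 b3
    set t3 := PowerSeries.coeff (M + 3) invSqrtQuartic / 2 ^ (M + 3) with ht3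
    set t2 := PowerSeries.coeff (M + 2) invSqrtQuartic / 2 ^ (M + 2) with ht2
    set t1 := PowerSeries.coeff (M + 1) invSqrtQuartic / 2 ^ (M + 1) with ht1
    set t0 := PowerSeries.coeff M invSqrtQuartic / 2 ^ M with ht0
    have e : 2 ^ M - (PowerSeries.coeff (M + 3) invSqrtQuartic -
        PowerSeries.coeff (M + 2) invSqrtQuartic + PowerSeries.coeff (M + 1) invSqrtQuartic +
        PowerSeries.coeff M invSqrtQuartic) / 2 - 2 ^ (M + 2) * (1 / 4 - c * r) =
        2 ^ (M + 2) * (-(t3 - 8 / 7 * c * r) + (t2 - 8 / 7 * c * r) / 2 -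
          (t1 - 8 / 7 * c * r) / 4 - (t0 - 8 / 7 * c * r) / 8) := by
      rw [ht3, ht2, ht1, ht0, pow_succ _ (M + 2), pow_succ _ (M + 1), pow_succ _ M]
      field_simp
      ring
    rw [e, abs_mul, abs_of_pos (show (0 : ℝ) < 2 ^ (M + 2) by positivity),
      mul_comm (2 * C + |1 / 4 - c|), mul_assoc (2 ^ (M + 2)) (2 * C + _)]
    refine mul_le_mul_of_nonneg_left ?_ (show (0 : ℝ) ≤ 2 ^ (M + 2) by positivity)
    have hCr : 0 ≤ C * r ^ 3 := by positivity
    have hcr : 0 ≤ |1 / 4 - c| * r ^ 3 := by positivity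
    rw [abs_le] at *
    constructor <;> linarith [b0.1, b0.2, b1.1, b1.2, b2.1, b2.2, b3.1, b3.2]
end
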